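/- Fried–Kollár theorem: For every simple graph Γ there exists a field K such that the group of ring automorphisms of K is isomorphic to the group of graph automorphisms of Γ. -/

import Mathlib

noncomputable section

namespace FriedKollar

open Polynomial

/-- Substitution of `T ^ (1 / N)` into a polynomial. -/
def rootSubst (B : Type) [Field B] (N : ℕ) : B[X] →+* AddMonoidAlgebra B ℚ :=
  eval₂RingHom AddMonoidAlgebra.singleZeroRingHom (AddMonoidAlgebra.single ((N : ℚ)⁻¹) 1)

variable {B : Type} [Field B]

lemma rootSubst_C (N : ℕ) (c : B) : rootSubst B N (C c) = AddMonoidAlgebra.single 0 c := by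
  simp [rootSubst]

lemma rootSubst_X_pow (N j : ℕ) :
    rootSubst B N (X ^ j) = AddMonoidAlgebra.single ((j : ℚ) / N) 1 := by
  simp [rootSubst, AddMonoidAlgebra.single_pow, div_eq_mul_inv]

lemma rootSubst_expand {M : ℕ} (hM : M ≠ 0) (N : ℕ) (P : B[X]) :
    rootSubst B (N * M) (expand B M P) = rootSubst B N P := by
  have : (rootSubst B (N * M)).comp (expand B M : B[X] →+* B[X]) = rootSubst B N := by
    apply Polynomial.ringHom_ext
    · intro a
      simp [rootSubst]
    · simp only [rootSubst, RingHom.comp_apply, RingHom.coe_coe, expand_X, coe_eval₂RingHom,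
        eval₂_X_pow, eval₂_X, AddMonoidAlgebra.single_pow, one_pow]
      congr 1
      have : (M : ℚ) ≠ 0 := by exact_mod_cast hM
      push_cast
      rw [nsmul_eq_mul]
      field_simp
  exact congrArg (fun f => f P) this

lemma coeff_rootSubst {N : ℕ} (hN : N ≠ 0) (P : B[X]) (n : ℕ) :
    (rootSubst B N P).coeff ((n : ℚ) / N) = P.coeff n := by
  have hN' : (N : ℚ) ≠ 0 := by exact_mod_cast hN
  induction P using Polynomial.induction_on' with
  | add p q hp hq => simp [hp, hq]
  | monomial m a =>
    rw [← C_mul_X_pow_eq_monomial, map_mul, rootSubst_C, rootSubst_X_pow,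
      AddMonoidAlgebra.single_mul_single, AddMonoidAlgebra.coeff_single, Finsupp.single_apply,
      coeff_C_mul_X_pow]
    have : (0 + (m : ℚ) / N = n / N) ↔ n = m := by
      rw [zero_add, div_left_inj' hN']
      norm_cast
      exact eq_comm
    simp only [this, mul_one]

lemma rootSubst_injective {N : ℕ} (hN : N ≠ 0) : Function.Injective (rootSubst B N) := by
  intro P Q h
  ext n
  rw [← coeff_rootSubst hN, ← coeff_rootSubst hN, h]

lemma exists_eq_single_mul_rootSubst (a : AddMonoidAlgebra B ℚ) :
    ∃ N : ℕ, N ≠ 0 ∧ ∃ (k : ℚ) (P : B[X]),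
      a = AddMonoidAlgebra.single k 1 * rootSubst B N P := by
  induction a using AddMonoidAlgebra.induction_linear with
  | zero => exact ⟨1, one_ne_zero, 0, 0, by simp⟩
  | single k c => exact ⟨1, one_ne_zero, k, C c, by
      rw [rootSubst_C, AddMonoidAlgebra.single_mul_single]; simp⟩
  | add a b ha hb =>
    obtain ⟨N, hN, k, P, ha⟩ := ha
    obtain ⟨N', hN', l, Q, hb⟩ := hb
    have key : ∀ (a b : AddMonoidAlgebra B ℚ) (N N' : ℕ) (k l : ℚ) (P Q : B[X]), N ≠ 0 → N' ≠ 0 →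
        a = AddMonoidAlgebra.single k 1 * rootSubst B N P →
        b = AddMonoidAlgebra.single l 1 * rootSubst B N' Q → k ≤ l →
        ∃ N : ℕ, N ≠ 0 ∧ ∃ (k : ℚ) (P : B[X]),
          a + b = AddMonoidAlgebra.single k 1 * rootSubst B N P := by
      intro a b N N' k l P Q hN hN' ha hb hkl
      set D := (l - k).den with hD
      have hD0 : D ≠ 0 := (l - k).den_nz
      have hnum : ((l - k).num.toNat : ℚ) = (l - k).num := by
        have : (0 : ℤ) ≤ (l - k).num := Rat.num_nonneg.2 (sub_nonneg.2 hkl)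
        exact_mod_cast Int.toNat_of_nonneg this
      have hX : AddMonoidAlgebra.single (l - k) (1 : B)
          = rootSubst B D (X ^ (l - k).num.toNat) := by
        rw [rootSubst_X_pow, hnum, hD, Rat.num_div_den]
      refine ⟨N * (N' * D), by positivity, k, expand B (N' * D) P +
        expand B (N * N') (X ^ (l - k).num.toNat) * expand B (N * D) Q, ?_⟩
      rw [map_add, map_mul, rootSubst_expand (by positivity),
        show N * (N' * D) = D * (N * N') by ring, rootSubst_expand (by positivity), ← hX,
        show D * (N * N') = N' * (N * D) by ring, rootSubst_expand (by positivity), mul_add,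
        ← mul_assoc, AddMonoidAlgebra.single_mul_single, ha, hb]
      simp
    rcases le_total k l with h | h
    · exact key a b N N' k l P Q hN hN' ha hb h
    · rw [add_comm]
      exact key b a N' N l k Q P hN' hN hb ha h

lemma rootMultiplicity_expand_of_ne_zero {m : ℕ} (hm : (m : B) ≠ 0) (f : B[X]) {b : B}
    (hb : b ≠ 0) : (expand B m f).rootMultiplicity b = f.rootMultiplicity (b ^ m) := by
  have hm0 : 0 < m := Nat.pos_of_ne_zero (by rintro rfl; simp at hm)
  obtain rfl | h0 := eq_or_ne f 0
  · simp
  obtain ⟨g, hg, ndvd⟩ := f.exists_eq_pow_rootMultiplicity_mul_and_not_dvd h0 (b ^ m)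
  obtain ⟨h, hh⟩ : X - C b ∣ (X ^ m - C (b ^ m) : B[X]) := by
    rw [dvd_iff_isRoot]; simp
  have hhb : h.eval b ≠ 0 := by
    have := congrArg (fun p => (derivative p).eval b) hh
    simp only [derivative_sub, derivative_X_pow, derivative_C, derivative_mul] at this
    simp at this
    rw [← this]
    exact mul_ne_zero hm (pow_ne_zero _ hb)
  rw [dvd_iff_isRoot, IsRoot.def] at ndvd
  set k := f.rootMultiplicity (b ^ m)
  have e : expand B m f = (h ^ k * expand B m g) * (X - C b) ^ k := by
    conv_lhs => rw [hg]
    rw [map_mul, map_pow, map_sub, expand_X, expand_C, hh, mul_pow]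
    ring
  have hev : (h ^ k * expand B m g).eval b ≠ 0 := by
    rw [eval_mul, eval_pow, expand_eval]
    exact mul_ne_zero (pow_ne_zero _ hhb) ndvd
  rw [e, rootMultiplicity_mul_X_sub_C_pow (by intro h; simp [h] at hev),
    rootMultiplicity_eq_zero hev, zero_add]

lemma rootMultiplicity_expand [CharP B 2] {M : ℕ} (hM : M ≠ 0) :
    ∃ v : ℕ, ∀ (f : B[X]) (b : B), b ≠ 0 →
      (expand B M f).rootMultiplicity b = 2 ^ v * f.rootMultiplicity (b ^ M) := by
  obtain ⟨v, m, hm, rfl⟩ := Nat.exists_eq_two_pow_mul_odd hM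
  have : ExpChar B 2 := ExpChar.prime Nat.prime_two
  refine ⟨v, fun f b hb => ?_⟩
  rw [expand_mul, rootMultiplicity_expand_pow, rootMultiplicity_expand_of_ne_zero,
    pow_mul]
  · rw [Ne, CharP.cast_eq_zero_iff B 2, ← even_iff_two_dvd, Nat.not_even_iff_odd]
    exact hm
  · exact pow_ne_zero _ hb

lemma rootMultiplicity_pow' (P : B[X]) (n : ℕ) (c : B) :
    (P ^ n).rootMultiplicity c = n * P.rootMultiplicity c := by
  classical
  rw [← count_roots, ← count_roots, roots_pow, Multiset.count_nsmul]

lemma rootMultiplicity_eq_of_divisible [IsAlgClosed B] [CharP B 2] {p : ℕ} (hp : p.Prime)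
    (hp2 : p ≠ 2) {P Q : B[X]} (hP : P ≠ 0) (hQ : Q ≠ 0)
    (h : ∀ n, ∃ M ≠ 0, ∃ P' Q' : B[X], P' ≠ 0 ∧ Q' ≠ 0 ∧ ∃ i j : ℕ,
      X ^ i * (expand B M P * Q' ^ p ^ n) = X ^ j * (expand B M Q * P' ^ p ^ n)) {b : B}
    (hb : b ≠ 0) : P.rootMultiplicity b = Q.rootMultiplicity b := by
  have hX : ∀ (c : B) (i : ℕ), c ≠ 0 → rootMultiplicity c (X ^ i : B[X]) = 0 := by
    intro c i hc
    apply rootMultiplicity_eq_zero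
    simp [hc]
  have key : ∀ n, (p ^ n : ℤ) ∣ (P.rootMultiplicity b : ℤ) - Q.rootMultiplicity b := by
    intro n
    obtain ⟨M, hM, P', Q', hP', hQ', i, j, e⟩ := h n
    obtain ⟨v, hv⟩ := rootMultiplicity_expand (B := B) hM
    obtain ⟨c, hc⟩ := IsAlgClosed.exists_pow_nat_eq b (Nat.pos_of_ne_zero hM)
    have hc0 : c ≠ 0 := by rintro rfl; apply hb; rw [← hc, zero_pow hM]
    have e2 := congrArg (rootMultiplicity c) e
    have hne : ∀ {F G : B[X]} (i : ℕ), F ≠ 0 → G ≠ 0 →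
        X ^ i * (expand B M F * G ^ p ^ n) ≠ 0 := fun i hF hG =>
      mul_ne_zero (pow_ne_zero _ X_ne_zero) (mul_ne_zero
        ((expand_ne_zero (Nat.pos_of_ne_zero hM)).2 hF) (pow_ne_zero _ hG))
    rw [rootMultiplicity_mul (hne i hP hQ'), rootMultiplicity_mul (hne j hQ hP'),
      rootMultiplicity_mul (right_ne_zero_of_mul (hne i hP hQ')),
      rootMultiplicity_mul (right_ne_zero_of_mul (hne j hQ hP')),
      hX c i hc0, hX c j hc0, hv _ _ hc0, hv _ _ hc0, hc,
      rootMultiplicity_pow', rootMultiplicity_pow', zero_add, zero_add] at e2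
    have hcop : IsCoprime ((p : ℤ) ^ n) (2 ^ v) := by
      apply IsCoprime.pow
      rw [show (2 : ℤ) = (2 : ℕ) by rfl, Nat.isCoprime_iff_coprime]
      exact (Nat.coprime_primes hp Nat.prime_two).2 hp2
    refine hcop.dvd_of_dvd_mul_left ⟨(P'.rootMultiplicity c : ℤ) - Q'.rootMultiplicity c, ?_⟩
    zify at e2
    linarith
  have : (P.rootMultiplicity b : ℤ) - Q.rootMultiplicity b = 0 := by
    refine Int.eq_zero_of_abs_lt_dvd
      (key ((P.rootMultiplicity b : ℤ) - Q.rootMultiplicity b).natAbs) ?_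
    rw [Int.abs_eq_natAbs]
    exact_mod_cast Nat.lt_pow_self hp.one_lt
  lia

lemma eq_mul_X_pow_of_rootMultiplicity [IsAlgClosed B] {P Q : B[X]} (hP : P ≠ 0) (hQ : Q ≠ 0)
    (h : ∀ b ≠ 0, P.rootMultiplicity b = Q.rootMultiplicity b) :
    ∃ (a b : B) (i j : ℕ), a ≠ 0 ∧ b ≠ 0 ∧ C a * X ^ i * P = C b * X ^ j * Q := by
  refine ⟨Q.leadingCoeff, P.leadingCoeff, Q.rootMultiplicity 0, P.rootMultiplicity 0,
    by simpa, by simpa, ?_⟩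
  have hr : (X ^ Q.rootMultiplicity 0 * P).roots = (X ^ P.rootMultiplicity 0 * Q).roots := by
    classical
    refine Multiset.ext.2 fun b => ?_
    rw [roots_mul (by simp [hP]), roots_mul (by simp [hQ]), roots_X_pow, roots_X_pow]
    simp only [Multiset.count_add, Multiset.count_nsmul, count_roots, Multiset.count_singleton]
    by_cases hb : b = 0
    · subst hb; simp [add_comm]
    · simp [hb, h b hb]
  have h1 := (IsAlgClosed.splits (X ^ Q.rootMultiplicity 0 * P)).eq_prod_roots
  have h2 := (IsAlgClosed.splits (X ^ P.rootMultiplicity 0 * Q)).eq_prod_roots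
  rw [mul_assoc, mul_assoc, h1, h2, hr]
  simp only [leadingCoeff_mul, leadingCoeff_X_pow, one_mul]
  ring

lemma exists_expand_eq_of_rootSubst_eq {N : ℕ} (hN : N ≠ 0) {k : ℚ} {U V : B[X]}
    (h : AddMonoidAlgebra.single k 1 * rootSubst B N U = rootSubst B N V) :
    ∃ D ≠ 0, ∃ i j : ℕ, X ^ i * expand B D U = X ^ j * expand B D V := by
  have hN' : (N : ℚ) ≠ 0 := by exact_mod_cast hN
  refine ⟨k.den, k.den_nz, k.num.toNat * N, (-k.num).toNat * N, ?_⟩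
  apply rootSubst_injective (mul_ne_zero hN k.den_nz)
  rw [map_mul, map_mul, rootSubst_expand k.den_nz, rootSubst_expand k.den_nz, ← h,
    rootSubst_X_pow, rootSubst_X_pow, ← mul_assoc, AddMonoidAlgebra.single_mul_single]
  have hden : (k.den : ℚ) ≠ 0 := by exact_mod_cast k.den_nz
  have e : (k.num.toNat : ℚ) = k.num + (-k.num).toNat := by
    exact_mod_cast (by lia : (k.num.toNat : ℤ) = k.num + (-k.num).toNat)
  have e2 : k = k.num / k.den := (Rat.num_div_den k).symm
  have e3 : ((k.num.toNat * N : ℕ) : ℚ) / (N * k.den : ℕ)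
      = ((-k.num).toNat * N : ℕ) / (N * k.den : ℕ) + k := by
    conv_rhs => arg 2; rw [e2]
    push_cast
    rw [e]
    field_simp
    ring
  rw [e3, one_mul]

section Fraction

variable {F : Type} [Field F] [Algebra (AddMonoidAlgebra B ℚ) F]
  [IsFractionRing (AddMonoidAlgebra B ℚ) F]

lemma exists_mul_rootSubst_eq {z : F} (hz : z ≠ 0) :
    ∃ N ≠ 0, ∃ (k : ℚ) (P Q : B[X]), P ≠ 0 ∧ Q ≠ 0 ∧
      z * algebraMap _ F (rootSubst B N Q) =
        algebraMap _ F (AddMonoidAlgebra.single k 1 * rootSubst B N P) := by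
  obtain ⟨a, d, hd, rfl⟩ := IsFractionRing.div_surjective (A := AddMonoidAlgebra B ℚ) z
  have hd0 : d ≠ 0 := nonZeroDivisors.ne_zero hd
  have ha0 : a ≠ 0 := by rintro rfl; simp at hz
  obtain ⟨N, hN, k, P, rfl⟩ := exists_eq_single_mul_rootSubst a
  obtain ⟨N', hN', l, Q, rfl⟩ := exists_eq_single_mul_rootSubst d
  refine ⟨N * N', mul_ne_zero hN hN', k - l, expand B N' P, expand B N Q, ?_, ?_, ?_⟩
  · rw [expand_ne_zero (Nat.pos_of_ne_zero hN')]
    rintro rfl; simp at ha0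
  · rw [expand_ne_zero (Nat.pos_of_ne_zero hN)]
    rintro rfl; simp at hd0
  rw [rootSubst_expand hN', mul_comm N N', rootSubst_expand hN]
  have hne : algebraMap _ F (AddMonoidAlgebra.single l 1 * rootSubst B N' Q) ≠ 0 := by
    rwa [Ne, map_eq_zero_iff _ (IsFractionRing.injective _ F)]
  rw [div_mul_eq_mul_div, div_eq_iff hne, ← map_mul, ← map_mul]
  congr 1
  rw [show k = (k - l) + l by ring]
  conv_lhs => rw [← one_mul (1 : B), ← AddMonoidAlgebra.single_mul_single]
  simp only [sub_add_cancel]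
  ring

/-- Over an algebraically closed field of characteristic two, a rational function in the
fractional powers of `T` which is infinitely divisible by an odd prime is a monomial. -/
lemma eq_single_of_divisible [IsAlgClosed B] [CharP B 2] {p : ℕ} (hp : p.Prime) (hp2 : p ≠ 2)
    {z : F} (hz : z ≠ 0) (h : ∀ n : ℕ, ∃ w, w ^ p ^ n = z) :
    ∃ (r : ℚ) (b : B), z = algebraMap _ F (AddMonoidAlgebra.single r b) := by
  have hinj := IsFractionRing.injective (AddMonoidAlgebra B ℚ) F
  obtain ⟨N, hN, k, P, Q, hP, hQ, e⟩ := exists_mul_rootSubst_eq (B := B) hz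
  have hmult : ∀ b ≠ 0, P.rootMultiplicity b = Q.rootMultiplicity b := by
    refine fun b => rootMultiplicity_eq_of_divisible hp hp2 hP hQ fun n => ?_
    obtain ⟨w, hw⟩ := h n
    have hw0 : w ≠ 0 := by
      rintro rfl
      exact hz (by rw [← hw, zero_pow (pow_ne_zero _ hp.ne_zero)])
    obtain ⟨N', hN', k', P', Q', hP', hQ', e'⟩ := exists_mul_rootSubst_eq (B := B) hw0
    have e1 : AddMonoidAlgebra.single k 1 * rootSubst B N P * rootSubst B N' Q' ^ p ^ n =
        rootSubst B N Q * (AddMonoidAlgebra.single k' 1 * rootSubst B N' P') ^ p ^ n := by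
      apply hinj
      rw [map_mul, ← e, map_mul _ (rootSubst B N Q), map_pow, map_pow, ← e', mul_pow, hw]
      ring
    have e2 : AddMonoidAlgebra.single (k - p ^ n • k') 1 *
        rootSubst B (N * N') (expand B N' P * expand B N Q' ^ p ^ n) =
        rootSubst B (N * N') (expand B N' Q * expand B N P' ^ p ^ n) := by
      rw [map_mul, map_mul, map_pow, map_pow, rootSubst_expand hN', rootSubst_expand hN',
        mul_comm N N', rootSubst_expand hN, rootSubst_expand hN]
      rw [mul_pow, AddMonoidAlgebra.single_pow, one_pow] at e1
      have := congrArg (AddMonoidAlgebra.single (-(p ^ n • k')) (1 : B) * ·) e1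
      simp only [← mul_assoc, AddMonoidAlgebra.single_mul_single, mul_one] at this ⊢
      rw [sub_eq_neg_add, this, mul_comm (AddMonoidAlgebra.single _ _), mul_assoc (rootSubst B N Q),
        AddMonoidAlgebra.single_mul_single, neg_add_cancel, mul_one, ← AddMonoidAlgebra.one_def,
        mul_one]
    obtain ⟨D, hD, i, j, e3⟩ := exists_expand_eq_of_rootSubst_eq (mul_ne_zero hN hN') e2
    refine ⟨D * N', mul_ne_zero hD hN', expand B D (expand B N P'), expand B D (expand B N Q'),
      ?_, ?_, i, j, ?_⟩
    · rw [expand_ne_zero (Nat.pos_of_ne_zero hD), expand_ne_zero (Nat.pos_of_ne_zero hN)]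
      exact hP'
    · rw [expand_ne_zero (Nat.pos_of_ne_zero hD), expand_ne_zero (Nat.pos_of_ne_zero hN)]
      exact hQ'
    · simpa [expand_mul] using e3
  obtain ⟨a, b, i, j, ha, hb, e4⟩ := eq_mul_X_pow_of_rootMultiplicity hP hQ hmult
  have e5 := congrArg (rootSubst B N) e4
  simp only [map_mul, rootSubst_C, rootSubst_X_pow, AddMonoidAlgebra.single_mul_single,
    mul_one, zero_add] at e5
  refine ⟨k + (j / N - i / N), a⁻¹ * b, ?_⟩
  have hQ0 : algebraMap _ F (rootSubst B N Q) ≠ 0 := by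
    rw [Ne, map_eq_zero_iff _ hinj, map_eq_zero_iff _ (rootSubst_injective hN)]
    exact hQ
  apply mul_right_cancel₀ hQ0
  rw [e, ← map_mul]
  congr 1
  have : rootSubst B N P = AddMonoidAlgebra.single (-((i : ℚ) / N)) a⁻¹ *
      (AddMonoidAlgebra.single ((i : ℚ) / N) a * rootSubst B N P) := by
    rw [← mul_assoc, AddMonoidAlgebra.single_mul_single, inv_mul_cancel₀ ha, neg_add_cancel,
      ← AddMonoidAlgebra.one_def, one_mul]
  rw [this, e5, ← mul_assoc, ← mul_assoc, AddMonoidAlgebra.single_mul_single,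
    AddMonoidAlgebra.single_mul_single, one_mul]
  congr 2
  ring

end Fraction

section Coaction

variable {k : Type} [Field k] {ι : Type}

/-- The part of `P` consisting of the monomials whose `i`-th exponent is `s`. -/
def fiberPart (i : ι) (s : ℚ) (P : AddMonoidAlgebra k (ι →₀ ℚ)) : AddMonoidAlgebra k (ι →₀ ℚ) :=
  AddMonoidAlgebra.ofCoeff (P.coeff.filter fun τ => τ i = s)

lemma coeff_fiberPart (i : ι) (s : ℚ) (P : AddMonoidAlgebra k (ι →₀ ℚ)) (τ : ι →₀ ℚ) :
    (fiberPart i s P).coeff τ = if τ i = s then P.coeff τ else 0 := by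
  simp [fiberPart, Finsupp.filter_apply]

lemma fiberPart_zero (i : ι) (s : ℚ) :
    fiberPart i s (0 : AddMonoidAlgebra k (ι →₀ ℚ)) = 0 := by
  ext τ
  simp [coeff_fiberPart]

variable {B : Type} [Field B]

/-- The coaction of the `i`-th one-parameter torus, with values in `B[T^ℚ]`. -/
def coaction (i : ι) (j : AddMonoidAlgebra k (ι →₀ ℚ) →+* B) :
    AddMonoidAlgebra k (ι →₀ ℚ) →+* AddMonoidAlgebra B ℚ :=
  AddMonoidAlgebra.liftNCRingHom
    ((AddMonoidAlgebra.singleZeroRingHom.comp j).comp AddMonoidAlgebra.singleZeroRingHom)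
    { toFun := fun τ => AddMonoidAlgebra.single (τ.toAdd i) (j (AddMonoidAlgebra.single τ.toAdd 1))
      map_one' := by
        simp [← AddMonoidAlgebra.one_def]
      map_mul' := fun a b => by
        rw [AddMonoidAlgebra.single_mul_single, ← map_mul, AddMonoidAlgebra.single_mul_single]
        simp }
    (fun _ _ => Commute.all _ _)

lemma coaction_single (i : ι) (j : AddMonoidAlgebra k (ι →₀ ℚ) →+* B) (τ : ι →₀ ℚ) (c : k) :
    coaction i j (AddMonoidAlgebra.single τ c) =
      AddMonoidAlgebra.single (τ i) (j (AddMonoidAlgebra.single τ c)) := by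
  have : (AddMonoidAlgebra.single τ c : AddMonoidAlgebra k (ι →₀ ℚ)) =
      AddMonoidAlgebra.single 0 c * AddMonoidAlgebra.single τ 1 := by
    rw [AddMonoidAlgebra.single_mul_single]; simp
  rw [this, map_mul j]
  simp [coaction, AddMonoidAlgebra.liftNCRingHom, AddMonoidAlgebra.single_mul_single]

lemma coeff_coaction (i : ι) (j : AddMonoidAlgebra k (ι →₀ ℚ) →+* B)
    (P : AddMonoidAlgebra k (ι →₀ ℚ)) (s : ℚ) :
    (coaction i j P).coeff s = j (fiberPart i s P) := by
  classical
  induction P using AddMonoidAlgebra.induction_linear with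
  | zero => simp [fiberPart_zero]
  | add P Q hP hQ =>
    rw [map_add, AddMonoidAlgebra.coeff_add, Finsupp.add_apply, hP, hQ, ← map_add]
    congr 1
    simp [fiberPart, Finsupp.filter_add]
  | single τ c =>
    rw [coaction_single, AddMonoidAlgebra.coeff_single, Finsupp.single_apply]
    split_ifs with h
    · congr 1
      ext σ
      rw [coeff_fiberPart, AddMonoidAlgebra.coeff_single, Finsupp.single_apply]
      split_ifs with h1 h2 h2 <;> simp_all
    · symm
      convert map_zero j
      ext σ
      rw [coeff_fiberPart, AddMonoidAlgebra.coeff_single, Finsupp.single_apply]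
      split_ifs with h1 <;> simp_all

/-- Evaluation at `T = 1`. -/
def counit (B : Type) [Field B] : AddMonoidAlgebra B ℚ →+* B :=
  AddMonoidAlgebra.liftNCRingHom (RingHom.id B) 1 (fun _ _ => Commute.all _ _)

lemma counit_single (r : ℚ) (b : B) : counit B (AddMonoidAlgebra.single r b) = b := by
  simp [counit, AddMonoidAlgebra.liftNCRingHom]

lemma counit_coaction (i : ι) (j : AddMonoidAlgebra k (ι →₀ ℚ) →+* B)
    (P : AddMonoidAlgebra k (ι →₀ ℚ)) : counit B (coaction i j P) = j P := by
  induction P using AddMonoidAlgebra.induction_linear with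
  | zero => simp
  | add P Q hP hQ => simp [hP, hQ]
  | single τ c => rw [coaction_single, counit_single]

variable {F : Type} [Field F] [Algebra (AddMonoidAlgebra k (ι →₀ ℚ)) F]
  [IsFractionRing (AddMonoidAlgebra k (ι →₀ ℚ)) F]

lemma exists_fiberPart_eq [CharP k 2] {p : ℕ} (hp : p.Prime) (hp2 : p ≠ 2) {z : F}
    (hz : z ≠ 0) (h : ∀ n : ℕ, ∃ w, w ^ p ^ n = z) {P Q : AddMonoidAlgebra k (ι →₀ ℚ)}
    (e : z * algebraMap _ F Q = algebraMap _ F P) (i : ι) :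
    ∃ r : ℚ, ∀ s, z * algebraMap _ F (fiberPart i s Q) =
      algebraMap _ F (fiberPart i (s + r) P) := by
  rcases eq_or_ne Q 0 with rfl | hQ
  · refine ⟨0, fun s => ?_⟩
    have hP : P = 0 := by
      rw [map_zero, mul_zero] at e
      exact (map_eq_zero_iff _ (IsFractionRing.injective _ F)).1 e.symm
    subst hP
    simp [fiberPart_zero]
  let B := AlgebraicClosure F
  let j : AddMonoidAlgebra k (ι →₀ ℚ) →+* B := (algebraMap F B).comp (algebraMap _ F)
  have hj : Function.Injective j :=
    (algebraMap F B).injective.comp (IsFractionRing.injective _ F)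
  have : CharP B 2 := charP_of_injective_ringHom
    (f := j.comp AddMonoidAlgebra.singleZeroRingHom)
    (RingHom.injective _) 2
  let E := FractionRing (AddMonoidAlgebra B ℚ)
  have hinj := IsFractionRing.injective (AddMonoidAlgebra B ℚ) E
  have hco : Function.Injective (coaction i j) := by
    intro x y hxy
    apply hj
    rw [← counit_coaction i j, hxy, counit_coaction]
  let Ψ : F →+* E := IsFractionRing.lift
    (g := (algebraMap (AddMonoidAlgebra B ℚ) E).comp (coaction i j)) (hinj.comp hco)
  have hΨ : ∀ x, Ψ (algebraMap _ F x) = algebraMap _ E (coaction i j x) := fun x =>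
    IsFractionRing.lift_algebraMap _ x
  obtain ⟨r, b, hb⟩ := eq_single_of_divisible (B := B) (F := E) hp hp2 (z := Ψ z)
    (by simpa using hz) (fun n => by
      obtain ⟨w, hw⟩ := h n
      exact ⟨Ψ w, by rw [← map_pow, hw]⟩)
  have e1 : AddMonoidAlgebra.single r b * coaction i j Q = coaction i j P := by
    apply hinj
    rw [map_mul, ← hb, ← hΨ, ← hΨ, ← map_mul, e]
  have hb2 : b = algebraMap F B z := by
    have e2 := congrArg (counit B) e1
    rw [map_mul, counit_single, counit_coaction, counit_coaction] at e2
    have hQ0 : j Q ≠ 0 := by rwa [Ne, map_eq_zero_iff _ hj]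
    apply mul_right_cancel₀ hQ0
    rw [e2]
    simp only [j, RingHom.comp_apply, ← map_mul, e]
  refine ⟨r, fun s => (algebraMap F B).injective ?_⟩
  have e3 := congrArg (fun x => x.coeff (s + r)) e1
  simp only [coeff_coaction, AddMonoidAlgebra.coeff_single_mul_apply] at e3
  rw [show -r + (s + r) = s by ring, hb2] at e3
  rw [map_mul]
  exact e3

/-- In the fraction field of `k[X^ℚ]` with `k` of characteristic two, the elements which are
infinitely divisible by an odd prime are monomials. -/
lemma exists_eq_single_of_divisible [CharP k 2] {p : ℕ} (hp : p.Prime) (hp2 : p ≠ 2) {z : F}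
    (hz : z ≠ 0) (h : ∀ n : ℕ, ∃ w, w ^ p ^ n = z) :
    ∃ (τ : ι →₀ ℚ) (c : k), z = algebraMap _ F (AddMonoidAlgebra.single τ c) := by
  classical
  have hinj := IsFractionRing.injective (AddMonoidAlgebra k (ι →₀ ℚ)) F
  have hex : ∃ n, ∃ P Q : AddMonoidAlgebra k (ι →₀ ℚ), Q ≠ 0 ∧
      z * algebraMap _ F Q = algebraMap _ F P ∧ Q.coeff.support.card = n := by
    obtain ⟨a, d, hd, rfl⟩ := IsFractionRing.div_surjective (A := AddMonoidAlgebra k (ι →₀ ℚ)) z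
    have hd0 := nonZeroDivisors.ne_zero hd
    refine ⟨_, a, d, hd0, ?_, rfl⟩
    rw [div_mul_cancel₀]
    rwa [Ne, map_eq_zero_iff _ hinj]
  obtain ⟨P, Q, hQ, e, hcard⟩ := Nat.find_spec hex
  have hmin := fun m => Nat.find_min (m := m) hex
  rw [← hcard] at hmin
  have hQfib : ∀ τ ∈ Q.coeff.support, ∀ σ ∈ Q.coeff.support, ∀ i, τ i = σ i := by
    intro τ hτ σ hσ i
    by_contra hne
    obtain ⟨r, hr⟩ := exists_fiberPart_eq hp hp2 hz h e i
    have hsub : (fiberPart i (τ i) Q).coeff.support ⊂ Q.coeff.support := by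
      rw [Finset.ssubset_iff_of_subset]
      · refine ⟨σ, hσ, ?_⟩
        rw [Finsupp.notMem_support_iff, coeff_fiberPart, if_neg (Ne.symm hne)]
      · intro ρ hρ
        rw [Finsupp.mem_support_iff, coeff_fiberPart] at hρ
        rw [Finsupp.mem_support_iff]
        intro h0
        simp [h0] at hρ
    refine hmin _ (Finset.card_lt_card hsub) ⟨_, _, ?_, hr (τ i), rfl⟩
    intro h0
    have := congrArg (fun x => x.coeff τ) h0
    simp only [coeff_fiberPart, if_true] at this
    exact Finsupp.mem_support_iff.1 hτ this
  have hmono : ∀ S : AddMonoidAlgebra k (ι →₀ ℚ), S ≠ 0 →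
      (∀ τ ∈ S.coeff.support, ∀ σ ∈ S.coeff.support, ∀ i, τ i = σ i) →
      ∃ τ c, c ≠ 0 ∧ S = AddMonoidAlgebra.single τ c := by
    intro S hS hfib
    have : S.coeff ≠ 0 := fun h0 => hS (by ext; simp [h0])
    obtain ⟨τ, hτ⟩ := Finsupp.support_nonempty_iff.2 this
    refine ⟨τ, S.coeff τ, Finsupp.mem_support_iff.1 hτ, ?_⟩
    ext σ
    rw [AddMonoidAlgebra.coeff_single, Finsupp.single_apply]
    split_ifs with hσ
    · rw [hσ]
    · by_contra h0
      exact hσ (Finsupp.ext (hfib τ hτ σ (Finsupp.mem_support_iff.2 h0)))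
  obtain ⟨τ, c, hc, hQs⟩ := hmono Q hQ hQfib
  have hQ0 : algebraMap _ F Q ≠ 0 := by rwa [Ne, map_eq_zero_iff _ hinj]
  have hP : P ≠ 0 := by
    rintro rfl
    rw [map_zero] at e
    exact mul_ne_zero hz hQ0 e
  have hPfib : ∀ σ ∈ P.coeff.support, ∀ ρ ∈ P.coeff.support, ∀ i, σ i = ρ i := by
    intro σ hσ ρ hρ i
    obtain ⟨r, hr⟩ := exists_fiberPart_eq hp hp2 hz h e i
    have hQQ : fiberPart i (τ i) Q = Q := by
      ext υ
      rw [coeff_fiberPart, hQs, AddMonoidAlgebra.coeff_single, Finsupp.single_apply]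
      split_ifs with h1 h2 h2 <;> simp_all
    have hPP := hr (τ i)
    rw [hQQ, e] at hPP
    have hPP := hinj hPP
    have : ∀ υ ∈ P.coeff.support, υ i = τ i + r := by
      intro υ hυ
      by_contra hne
      have := congrArg (fun x => x.coeff υ) hPP
      simp only [coeff_fiberPart, if_neg hne] at this
      exact Finsupp.mem_support_iff.1 hυ this
    rw [this σ hσ, this ρ hρ]
  obtain ⟨σ, d, -, hPs⟩ := hmono P hP hPfib
  refine ⟨σ - τ, d * c⁻¹, mul_right_cancel₀ hQ0 ?_⟩
  rw [e, ← map_mul, hPs, hQs, AddMonoidAlgebra.single_mul_single, sub_add_cancel,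
    inv_mul_cancel_right₀ hc]

end Coaction

section Graded

open Classical in
/-- The grading concentrated on the subset `N`. -/
def onSet (k : Type) [Field k] {M : Type} (N : Set M) (i : M) : AddSubgroup k :=
  if i ∈ N then ⊤ else ⊥

lemma mem_onSet {k : Type} [Field k] {M : Type} {N : Set M} {i : M} {a : k} :
    a ∈ onSet k N i ↔ (a ≠ 0 → i ∈ N) := by
  unfold onSet
  split_ifs with h <;> simp [h]

variable {k : Type} [Field k] {M : Type} [AddCommGroup M]

lemma coeff_mul_mem (W₁ W₂ W₃ : M → AddSubgroup k)
    (h : ∀ {i j : M} {a b : k}, a ∈ W₁ i → b ∈ W₂ j → a * b ∈ W₃ (i + j))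
    {P Q : AddMonoidAlgebra k M} (hP : ∀ i, P.coeff i ∈ W₁ i) (hQ : ∀ i, Q.coeff i ∈ W₂ i) (i : M) :
    (P * Q).coeff i ∈ W₃ i := by
  classical
  rw [AddMonoidAlgebra.coeff_mul]
  unfold Finsupp.sum
  refine sum_mem fun a _ => sum_mem fun b _ => ?_
  beta_reduce
  split_ifs with hab
  · rw [← hab]; exact h (hP a) (hQ b)
  · exact zero_mem _

/-- The subring of `k[M]` of elements whose coefficients lie in a prescribed filtration. -/
def gradedSubring (W : M → AddSubgroup k) (h1 : 1 ∈ W 0)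
    (hmul : ∀ {i j : M} {a b : k}, a ∈ W i → b ∈ W j → a * b ∈ W (i + j)) :
    Subring (AddMonoidAlgebra k M) where
  carrier := {P | ∀ i, P.coeff i ∈ W i}
  mul_mem' hP hQ := coeff_mul_mem W W W hmul hP hQ
  one_mem' i := by
    classical
    rw [AddMonoidAlgebra.one_def, AddMonoidAlgebra.coeff_single, Finsupp.single_apply]
    split_ifs with h
    · rwa [← h]
    · exact zero_mem _
  add_mem' hP hQ i := by
    rw [AddMonoidAlgebra.coeff_add]
    exact add_mem (hP i) (hQ i)
  zero_mem' i := by simp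
  neg_mem' hP i := by
    rw [AddMonoidAlgebra.coeff_neg]
    exact neg_mem (hP i)

lemma exists_of_mem_closure {R F : Type} [CommRing R] [Field F] [Algebra R F] [IsDomain R]
    [IsFractionRing R F] (A : Subring R) {x : F}
    (hx : x ∈ Subfield.closure (algebraMap R F '' (A : Set R))) :
    ∃ P ∈ A, ∃ Q ∈ A, Q ≠ 0 ∧ x * algebraMap R F Q = algebraMap R F P := by
  rw [Subfield.mem_closure_iff] at hx
  have hA : Subring.closure (algebraMap R F '' (A : Set R)) = A.map (algebraMap R F) := by
    rw [← Subring.coe_map, Subring.closure_eq]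
  rw [hA] at hx
  obtain ⟨_, ⟨P, hP, rfl⟩, _, ⟨Q, hQ, rfl⟩, rfl⟩ := hx
  by_cases hQ0 : Q = 0
  · subst hQ0
    exact ⟨0, zero_mem _, 1, one_mem _, one_ne_zero, by simp⟩
  · refine ⟨P, hP, Q, hQ, hQ0, ?_⟩
    rw [div_mul_cancel₀]
    rwa [Ne, map_eq_zero_iff _ (IsFractionRing.injective R F)]

lemma mem_of_single_mem_closure {F : Type} [Field F] [Algebra (AddMonoidAlgebra k M) F]
    [IsDomain (AddMonoidAlgebra k M)] [IsFractionRing (AddMonoidAlgebra k M) F]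
    (W : M → AddSubgroup k) (h1 : 1 ∈ W 0)
    (hmul : ∀ {i j : M} {a b : k}, a ∈ W i → b ∈ W j → a * b ∈ W (i + j))
    (hinv : ∀ {i : M} {a : k}, a ∈ W i → a⁻¹ ∈ W (-i)) {i : M} {u : k}
    (hx : algebraMap (AddMonoidAlgebra k M) F (AddMonoidAlgebra.single i u) ∈
      Subfield.closure (algebraMap (AddMonoidAlgebra k M) F '' gradedSubring W h1 hmul)) :
    u ∈ W i := by
  obtain ⟨P, hP, Q, hQ, hQ0, e⟩ := exists_of_mem_closure _ hx
  rw [← map_mul] at e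
  have e := IsFractionRing.injective _ F e
  have : Q.coeff ≠ 0 := fun h0 => hQ0 (by ext; simp [h0])
  obtain ⟨s, hs⟩ := Finsupp.support_nonempty_iff.2 this
  rw [Finsupp.mem_support_iff] at hs
  have e2 := congrArg (fun x => x.coeff (i + s)) e
  simp only [AddMonoidAlgebra.coeff_single_mul_apply, neg_add_cancel_left] at e2
  rw [show u = P.coeff (i + s) * (Q.coeff s)⁻¹ by rw [← e2, mul_inv_cancel_right₀ hs]]
  have := hmul (hP (i + s)) (hinv (hQ s))
  rwa [add_neg_cancel_right] at this

/-- The elements of `k[M]` supported on the subgroup `N`. -/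
def supportedSubring (k : Type) [Field k] (N : AddSubgroup M) : Subring (AddMonoidAlgebra k M) :=
  gradedSubring (onSet k (N : Set M)) (mem_onSet.2 fun _ => N.zero_mem) (by
    intro i j a b ha hb
    rw [mem_onSet] at *
    exact fun h => N.add_mem (ha (left_ne_zero_of_mul h)) (hb (right_ne_zero_of_mul h)))

lemma mem_supportedSubring {N : AddSubgroup M} {P : AddMonoidAlgebra k M} :
    P ∈ supportedSubring k N ↔ ∀ i, P.coeff i ≠ 0 → i ∈ N :=
  forall_congr' fun _ => mem_onSet

lemma single_mem_supportedSubring {N : AddSubgroup M} {i : M} (hi : i ∈ N) (c : k) :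
    AddMonoidAlgebra.single i c ∈ supportedSubring k N := by
  classical
  rw [mem_supportedSubring]
  intro j hj
  rw [AddMonoidAlgebra.coeff_single, Finsupp.single_apply] at hj
  split_ifs at hj with h
  · rwa [← h]
  · exact absurd rfl hj

lemma mem_supportedSubring_of_mul [IsDomain (AddMonoidAlgebra k M)] {N : AddSubgroup M}
    {z P Q : AddMonoidAlgebra k M} (hP : P ∈ supportedSubring k N)
    (hQ : Q ∈ supportedSubring k N) (hQ0 : Q ≠ 0) (e : z * Q = P) :
    z ∈ supportedSubring k N := by
  classical
  let z₁ : AddMonoidAlgebra k M := AddMonoidAlgebra.ofCoeff (z.coeff.filter (· ∈ N))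
  have hz₁ : z₁ ∈ supportedSubring k N := by
    rw [mem_supportedSubring]
    intro i hi
    by_contra hiN
    exact hi (by simp [z₁, hiN])
  have hz₂ : ∀ i, (z - z₁).coeff i ∈ onSet k ((N : Set M)ᶜ) i := by
    intro i
    rw [mem_onSet]
    intro hi hiN
    apply hi
    rw [AddMonoidAlgebra.coeff_sub]
    simp [z₁, show i ∈ N from hiN]
  have h1 := coeff_mul_mem _ (onSet k (N : Set M)) (onSet k ((N : Set M)ᶜ)) (by
    intro i j a b ha hb
    rw [mem_onSet] at *
    intro h hij
    exact ha (left_ne_zero_of_mul h)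
      ((N.add_mem_cancel_right (hb (right_ne_zero_of_mul h))).1 hij)) hz₂ hQ
  have h2 : (z - z₁) * Q ∈ supportedSubring k N := by
    rw [sub_mul, e]
    exact sub_mem hP (mul_mem hz₁ hQ)
  have h3 : (z - z₁) * Q = 0 := by
    ext i
    by_contra h0
    exact mem_onSet.1 (h1 i) h0 (mem_supportedSubring.1 h2 i h0)
  rcases mul_eq_zero.1 h3 with h | h
  · rw [sub_eq_zero.1 h]; exact hz₁
  · exact absurd h hQ0

lemma sq_mem_supportedSubring [CharP k 2] {N : AddSubgroup M} {P : AddMonoidAlgebra k M}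
    (hP : P ∈ supportedSubring k N) :
    P ^ 2 ∈ supportedSubring k (N.map (nsmulAddMonoidHom 2 : M →+ M)) := by
  have hch : CharP (AddMonoidAlgebra k M) 2 := charP_of_injective_ringHom
    (f := (AddMonoidAlgebra.singleZeroRingHom : k →+* AddMonoidAlgebra k M))
    (RingHom.injective _) 2
  rw [← AddMonoidAlgebra.sum_coeff_single P, Finsupp.sum, sum_pow_char]
  refine sum_mem fun i hi => ?_
  rw [AddMonoidAlgebra.single_pow]
  refine single_mem_supportedSubring (AddSubgroup.mem_map.2 ⟨i, ?_, rfl⟩) _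
  exact mem_supportedSubring.1 hP i (Finsupp.mem_support_iff.1 hi)

end Graded

section Product

variable {V : Type}

open Classical in
lemma coeff_prod_one_add (Q : Finset (V →₀ ℚ)) (τ : V →₀ ℚ) :
    (∏ q ∈ Q, (1 + AddMonoidAlgebra.single q (1 : ZMod 2))).coeff τ =
      ∑ S ∈ Q.powerset, if ∑ q ∈ S, q = τ then 1 else 0 := by
  rw [Finset.prod_one_add]
  simp_rw [AddMonoidAlgebra.prod_single]
  rw [AddMonoidAlgebra.coeff_sum]
  simp only [Finset.prod_const_one, AddMonoidAlgebra.coeff_single, Finsupp.finsetSum_apply,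
    Finsupp.single_apply]

lemma coeff_zero_prod_one_add {Q : Finset (V →₀ ℚ)} (hQ : ∀ q ∈ Q, 0 < q.degree) :
    (∏ q ∈ Q, (1 + AddMonoidAlgebra.single q (1 : ZMod 2))).coeff 0 = 1 := by
  classical
  rw [coeff_prod_one_add, Finset.sum_eq_single ∅]
  · simp
  · intro S hS hne
    rw [if_neg]
    intro h0
    have := congrArg Finsupp.degree h0
    rw [map_sum, map_zero] at this
    exact (Finset.sum_pos (fun q hq => hQ q (Finset.mem_powerset.1 hS hq))
      (Finset.nonempty_iff_ne_empty.2 hne)).ne' this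
  · simp

lemma coeff_prod_one_add_of_degree_nonpos {Q : Finset (V →₀ ℚ)} (hQ : ∀ q ∈ Q, 0 < q.degree)
    {τ : V →₀ ℚ} (hτ : τ.degree ≤ 0) (hτ0 : τ ≠ 0) :
    (∏ q ∈ Q, (1 + AddMonoidAlgebra.single q (1 : ZMod 2))).coeff τ = 0 := by
  classical
  rw [coeff_prod_one_add]
  refine Finset.sum_eq_zero fun S hS => if_neg fun h0 => ?_
  rcases S.eq_empty_or_nonempty with rfl | hne
  · exact hτ0 (by simpa using h0.symm)
  · have := congrArg Finsupp.degree h0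
    rw [map_sum] at this
    exact (this ▸ hτ).not_gt (Finset.sum_pos (fun q hq => hQ q (Finset.mem_powerset.1 hS hq)) hne)

lemma exists_coeff_prod_one_add_eq_one {Q : Finset (V →₀ ℚ)} (hQ : ∀ q ∈ Q, 0 < q.degree)
    (hne : Q.Nonempty) :
    ∃ q ∈ Q, (∏ q ∈ Q, (1 + AddMonoidAlgebra.single q (1 : ZMod 2))).coeff q = 1 := by
  classical
  obtain ⟨q, hq, hmin⟩ := Q.exists_min_image Finsupp.degree hne
  refine ⟨q, hq, ?_⟩
  rw [coeff_prod_one_add, Finset.sum_eq_single {q}]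
  · simp
  · intro S hS hSq
    rw [if_neg]
    intro h0
    have hS := Finset.mem_powerset.1 hS
    rcases S.eq_empty_or_nonempty with rfl | ⟨r, hr⟩
    · have := hQ q hq
      rw [← h0] at this
      simp at this
    · have h1 : q.degree = r.degree + ∑ s ∈ S.erase r, s.degree := by
        rw [Finset.add_sum_erase _ _ hr, ← map_sum, h0]
      have h2 : ∀ s ∈ S.erase r, 0 < s.degree := fun s hs =>
        hQ s (hS (Finset.mem_of_mem_erase hs))
      rcases (S.erase r).eq_empty_or_nonempty with h | h
      · have hSr : S = {r} := by
          rw [← Finset.insert_erase hr, h]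
          rfl
        subst hSr
        simp at h0
        exact hSq (by rw [h0])
      · have := Finset.sum_pos h2 h
        have := hmin r (hS hr)
        linarith
  · intro h
    exact absurd (by simpa using hq) h

end Product

section Inverted

/-- The rational numbers whose denominator is a power of `p`. -/
def zInv (p : ℕ) : AddSubgroup ℚ where
  carrier := {q | ∃ (n : ℕ) (a : ℤ), q * p ^ n = a}
  zero_mem' := ⟨0, 0, by simp⟩
  add_mem' := by
    rintro q r ⟨n, a, hq⟩ ⟨m, b, hr⟩
    refine ⟨n + m, a * p ^ m + b * p ^ n, ?_⟩
    push_cast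
    rw [← hq, ← hr]
    ring
  neg_mem' := by
    rintro q ⟨n, a, hq⟩
    exact ⟨n, -a, by push_cast; rw [← hq]; ring⟩

lemma intCast_mem_zInv (p : ℕ) (a : ℤ) : (a : ℚ) ∈ zInv p := ⟨0, a, by simp⟩

lemma div_pow_mem_zInv {p : ℕ} (hp : p ≠ 0) {q : ℚ} (hq : q ∈ zInv p) (n : ℕ) :
    q / p ^ n ∈ zInv p := by
  obtain ⟨m, a, h⟩ := hq
  have : (p : ℚ) ≠ 0 := by exact_mod_cast hp
  exact ⟨n + m, a, by rw [← h, pow_add]; field_simp⟩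

lemma exists_int_of_mem_zInv {p l : ℕ} (hpl : p.Coprime l) {q : ℚ} (hq : q ∈ zInv p) {n : ℕ}
    {a : ℤ} (ha : q * l ^ n = a) : ∃ b : ℤ, q = b := by
  obtain ⟨m, b, hb⟩ := hq
  obtain ⟨u, v, huv⟩ : IsCoprime ((p : ℤ) ^ m) ((l : ℤ) ^ n) :=
    (Nat.isCoprime_iff_coprime.2 hpl).pow
  refine ⟨u * b + v * a, ?_⟩
  push_cast
  rw [← ha, ← hb]
  have : (u : ℚ) * p ^ m + v * l ^ n = 1 := by exact_mod_cast huv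
  linear_combination -q * this

lemma eq_zero_of_forall_pow_dvd {l : ℕ} (hl : 1 < l) {a : ℤ} (h : ∀ n : ℕ, (l : ℤ) ^ n ∣ a) :
    a = 0 := by
  refine Int.eq_zero_of_abs_lt_dvd (h a.natAbs) ?_
  rw [Int.abs_eq_natAbs]
  exact_mod_cast Nat.lt_pow_self hl

lemma eq_zero_of_div_pow_mem_zInv {p l : ℕ} (hpl : p.Coprime l) (hp : p ≠ 0) (hl : 1 < l) {q : ℚ}
    (h : ∀ n : ℕ, q / l ^ n ∈ zInv p) : q = 0 := by
  have hl0 : (l : ℚ) ≠ 0 := by exact_mod_cast (by lia : l ≠ 0)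
  have hp0 : (p : ℚ) ≠ 0 := by exact_mod_cast hp
  obtain ⟨m, a, ha⟩ := h 0
  rw [pow_zero, div_one] at ha
  have ha0 : a = 0 := by
    refine eq_zero_of_forall_pow_dvd hl fun n => ?_
    have h1 : q / l ^ n * p ^ m ∈ zInv p := by
      have := (zInv p).nsmul_mem (h n) (p ^ m)
      rwa [nsmul_eq_mul, mul_comm, Nat.cast_pow] at this
    obtain ⟨b, hb⟩ := exists_int_of_mem_zInv hpl h1 (n := n) (a := a) (by
      rw [← ha]; field_simp)
    refine ⟨b, ?_⟩
    have : (a : ℚ) = l ^ n * b := by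
      rw [← ha, ← hb]; field_simp
    exact_mod_cast this
  rw [ha0, Int.cast_zero] at ha
  exact (mul_eq_zero.1 ha).resolve_right (pow_ne_zero _ hp0)

/-- The exponent vectors with all coordinates in `ℤ[1/p]`. -/
def zInvLattice (p : ℕ) (ι : Type) : AddSubgroup (ι →₀ ℚ) where
  carrier := {τ | ∀ i, τ i ∈ zInv p}
  zero_mem' _ := zero_mem _
  add_mem' ha hb i := add_mem (ha i) (hb i)
  neg_mem' ha i := neg_mem (ha i)

lemma single_mem_zInvLattice {p : ℕ} {ι : Type} (i : ι) {q : ℚ} (hq : q ∈ zInv p) :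
    Finsupp.single i q ∈ zInvLattice p ι := by
  classical
  intro j
  rw [Finsupp.single_apply]
  split_ifs
  · exact hq
  · exact zero_mem _

end Inverted

section BaseField

variable {V : Type}

/-- The field of rational functions over `𝔽₂` in all rational powers of the variables `V`. -/
abbrev BaseField (V : Type) : Type := FractionRing (AddMonoidAlgebra (ZMod 2) (V →₀ ℚ))

lemma charP_fractionRing (k : Type) [Field k] [CharP k 2] (ι : Type) :
    CharP (FractionRing (AddMonoidAlgebra k (ι →₀ ℚ))) 2 :=
  charP_of_injective_ringHom (f := (algebraMap (AddMonoidAlgebra k (ι →₀ ℚ)) _).comp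
    AddMonoidAlgebra.singleZeroRingHom) (RingHom.injective _) 2

instance : CharP (BaseField V) 2 := charP_fractionRing _ _

/-- The monomial with exponent vector `α`. -/
def eX (α : V →₀ ℚ) : BaseField V :=
  algebraMap (AddMonoidAlgebra (ZMod 2) (V →₀ ℚ)) _ (AddMonoidAlgebra.single α 1)

lemma eX_zero : eX (0 : V →₀ ℚ) = 1 := by
  rw [eX, ← AddMonoidAlgebra.one_def, map_one]

lemma eX_add (α β : V →₀ ℚ) : eX (α + β) = eX α * eX β := by
  rw [eX, eX, eX, ← map_mul, AddMonoidAlgebra.single_mul_single, one_mul]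

lemma eX_pow (α : V →₀ ℚ) (n : ℕ) : eX α ^ n = eX (n • α) := by
  rw [eX, eX, ← map_pow, AddMonoidAlgebra.single_pow, one_pow]

lemma eX_injective : Function.Injective (eX (V := V)) := by
  intro α β h
  have h := congrArg AddMonoidAlgebra.coeff (IsFractionRing.injective _ _ h)
  simpa using (Finsupp.single_eq_single_iff _ _ _ _).1 h

lemma eX_ne_zero (α : V →₀ ℚ) : eX α ≠ 0 := by
  intro h
  have := eX_add α (-α)
  rw [h, zero_mul, add_neg_cancel, eX_zero] at this
  exact one_ne_zero this

lemma eX_neg (α : V →₀ ℚ) : eX (-α) = (eX α)⁻¹ := by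
  apply eq_inv_of_mul_eq_one_left
  rw [← eX_add, neg_add_cancel, eX_zero]

lemma one_add_eX_ne_zero {α : V →₀ ℚ} (hα : α ≠ 0) : 1 + eX α ≠ 0 := by
  intro h
  apply hα
  apply eX_injective
  rw [eX_zero]
  exact (CharTwo.add_eq_zero.1 h).symm

lemma one_add_eX_pow (α : V →₀ ℚ) (n : ℕ) : (1 + eX α) ^ 2 ^ n = 1 + eX (2 ^ n • α) := by
  rw [add_pow_char_pow, one_pow, eX_pow]

variable (V) in
/-- The subfield generated by the monomials with exponents in `ℤ[1/3]`. -/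
def cubeField : Subfield (BaseField V) :=
  Subfield.closure (algebraMap (AddMonoidAlgebra (ZMod 2) (V →₀ ℚ)) (BaseField V) ''
    (supportedSubring (ZMod 2) (zInvLattice 3 V)))

lemma eX_mem_cubeField {α : V →₀ ℚ} : eX α ∈ cubeField V ↔ α ∈ zInvLattice 3 V := by
  constructor
  · intro h
    obtain ⟨P, hP, Q, hQ, hQ0, e⟩ := exists_of_mem_closure _ h
    rw [eX, ← map_mul] at e
    have := mem_supportedSubring_of_mul hP hQ hQ0 (IsFractionRing.injective _ _ e)
    exact mem_supportedSubring.1 this α (by simp)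
  · intro h
    exact Subfield.subset_closure ⟨_, single_mem_supportedSubring h 1, rfl⟩

variable (V) in
/-- The exponent vectors of the squares of monomials of `cubeField V`. -/
def squareLattice : AddSubgroup (V →₀ ℚ) :=
  (zInvLattice 3 V).map (nsmulAddMonoidHom 2 : (V →₀ ℚ) →+ (V →₀ ℚ))

lemma coeff_eq_zero_of_eq_sq {z : AddMonoidAlgebra (ZMod 2) (V →₀ ℚ)} {q : BaseField V}
    (hq : q ∈ cubeField V) (h : algebraMap _ (BaseField V) z = q ^ 2) {α : V →₀ ℚ}
    (hα : z.coeff α ≠ 0) : α ∈ squareLattice V := by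
  obtain ⟨P, hP, Q, hQ, hQ0, e⟩ := exists_of_mem_closure _ hq
  have e2 : z * Q ^ 2 = P ^ 2 := by
    apply IsFractionRing.injective _ (BaseField V)
    rw [map_mul, h, map_pow, map_pow, ← mul_pow, e]
  exact mem_supportedSubring.1 (mem_supportedSubring_of_mul (sq_mem_supportedSubring hP)
    (sq_mem_supportedSubring hQ) (pow_ne_zero _ hQ0) e2) α hα

end BaseField

/-- The conditions on the set of exponents marking the vertices and the edges of a graph. -/
structure IsAdmissible {V : Type} (J : Set (V →₀ ℚ)) : Prop where
  degree_pos : ∀ m ∈ J, 0 < m.degree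
  mem : ∀ m ∈ J, m ∈ zInvLattice 3 V
  notMem : ∀ m ∈ J, m ∉ squareLattice V

section Factors

variable {V : Type} {J : Set (V →₀ ℚ)}

lemma IsAdmissible.ne_zero (hJ : IsAdmissible J) (j : J) : j.1 ≠ 0 := by
  intro h
  have := hJ.degree_pos j.1 j.2
  rw [h] at this
  simp at this

/-- The product of the factors `1 + e^(m / 2 ^ N)`, `m ∈ J`, with prescribed multiplicities. -/
def factorProd (N : ℕ) (c : J →₀ ℤ) : BaseField V :=
  c.prod fun j a => (1 + eX (((2 : ℚ) ^ N)⁻¹ • j.1)) ^ a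

lemma IsAdmissible.one_add_ne_zero (hJ : IsAdmissible J) (N : ℕ) (j : J) :
    1 + eX (((2 : ℚ) ^ N)⁻¹ • j.1) ≠ 0 :=
  one_add_eX_ne_zero (smul_ne_zero (by positivity) (hJ.ne_zero j))

lemma factorProd_zero (N : ℕ) : factorProd N (0 : J →₀ ℤ) = 1 := Finsupp.prod_zero_index

lemma factorProd_single (N : ℕ) (j : J) (a : ℤ) :
    factorProd N (Finsupp.single j a) = (1 + eX (((2 : ℚ) ^ N)⁻¹ • j.1)) ^ a :=
  Finsupp.prod_single_index (zpow_zero _)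

lemma IsAdmissible.factorProd_add (hJ : IsAdmissible J) (N : ℕ) (c d : J →₀ ℤ) :
    factorProd N (c + d) = factorProd N c * factorProd N d := by
  classical
  exact Finsupp.prod_add_index' (fun _ => zpow_zero _)
    (fun j _ _ => zpow_add₀ (hJ.one_add_ne_zero N j) _ _)

lemma IsAdmissible.factorProd_ne_zero (hJ : IsAdmissible J) (N : ℕ) (c : J →₀ ℤ) :
    factorProd N c ≠ 0 :=
  Finset.prod_ne_zero_iff.2 fun j _ => zpow_ne_zero _ (hJ.one_add_ne_zero N j)

lemma IsAdmissible.factorProd_neg (hJ : IsAdmissible J) (N : ℕ) (c : J →₀ ℤ) :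
    factorProd N (-c) = (factorProd N c)⁻¹ := by
  apply eq_inv_of_mul_eq_one_left
  rw [← hJ.factorProd_add, neg_add_cancel,
    factorProd_zero]

lemma IsAdmissible.factorProd_nsmul (hJ : IsAdmissible J) (N n : ℕ) (c : J →₀ ℤ) :
    factorProd N (n • c) = factorProd N c ^ n := by
  induction n with
  | zero => rw [zero_smul, factorProd_zero, pow_zero]
  | succ n ih => rw [succ_nsmul, hJ.factorProd_add, ih, pow_succ]

lemma factorProd_add_nsmul (N n : ℕ) (c : J →₀ ℤ) :
    factorProd (N + n) ((2 ^ n : ℕ) • c) = factorProd N c := by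
  have : (2 ^ n : ℕ) • c = c.mapRange (fun a => (2 ^ n : ℕ) • a) (smul_zero _) := by
    ext; simp
  rw [factorProd, this, Finsupp.prod_mapRange_index (fun _ => zpow_zero _), factorProd]
  refine Finsupp.prod_congr fun j _ => ?_
  rw [nsmul_eq_mul, zpow_mul, zpow_natCast, one_add_eX_pow, ← Nat.cast_smul_eq_nsmul ℚ, smul_smul]
  congr 4
  push_cast
  rw [pow_add]
  field_simp

lemma factorProd_nsmul_self (N : ℕ) (c : J →₀ ℤ) :
    factorProd N ((2 ^ N : ℕ) • c) = factorProd 0 c := by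
  rw [← factorProd_add_nsmul 0 N, zero_add]

lemma IsAdmissible.factorProd_pow (hJ : IsAdmissible J) (N : ℕ) (c : J →₀ ℤ) :
    factorProd N c ^ 2 ^ N = factorProd 0 c := by
  rw [← hJ.factorProd_nsmul, factorProd_nsmul_self]

lemma IsAdmissible.factorProd_mem (hJ : IsAdmissible J) (c : J →₀ ℤ) :
    factorProd 0 c ∈ cubeField V := by
  refine prod_mem fun j _ => zpow_mem (add_mem (one_mem _) ?_) _
  rw [eX_mem_cubeField, pow_zero, inv_one, one_smul]
  exact hJ.mem j.1 j.2

lemma exists_eq_nsmul_of_dvd {ι : Type} {n : ℕ} {c : ι →₀ ℤ} (h : ∀ i, (n : ℤ) ∣ c i) :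
    ∃ d : ι →₀ ℤ, c = n • d := by
  refine ⟨c.mapRange (· / n) (by simp), ?_⟩
  ext i
  simp [Int.mul_ediv_cancel' (h i)]

/-- The Laurent polynomial `∏ (1 + e^m)`. -/
def oneAddProd (A : Finset (V →₀ ℚ)) : AddMonoidAlgebra (ZMod 2) (V →₀ ℚ) :=
  ∏ q ∈ A, (1 + AddMonoidAlgebra.single q 1)

lemma algebraMap_oneAddProd (A : Finset (V →₀ ℚ)) :
    algebraMap _ (BaseField V) (oneAddProd A) = ∏ q ∈ A, (1 + eX q) := by
  simp [oneAddProd, eX]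

lemma IsAdmissible.exists_factorProd_eq (hJ : IsAdmissible J) (c : J →₀ ℤ) :
    ∃ (d : J →₀ ℤ) (A : Finset (V →₀ ℚ)), (∀ q ∈ A, q ∈ J) ∧
      (A = ∅ → c = 2 • d) ∧
      factorProd 0 c = factorProd 0 d ^ 2 * algebraMap _ (BaseField V) (oneAddProd A) := by
  classical
  let B : Finset J := c.support.filter fun j => Odd (c j)
  have hB : ∀ j, ((2 : ℕ) : ℤ) ∣ ((c - ∑ i ∈ B, Finsupp.single i 1 : J →₀ ℤ) j) := by
    intro j
    have : (∑ i ∈ B, Finsupp.single i (1 : ℤ)) j = if j ∈ B then 1 else 0 := by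
      simp [Finsupp.finsetSum_apply, Finsupp.single_apply]
    rw [Finsupp.sub_apply, this]
    have hiff : j ∈ B ↔ Odd (c j) := by
      simp only [B, Finset.mem_filter, Finsupp.mem_support_iff, and_iff_right_iff_imp]
      rintro h h0
      simp [h0] at h
    rw [Nat.cast_ofNat, ← even_iff_two_dvd]
    split_ifs with h
    · exact (hiff.1 h).sub_odd odd_one
    · rw [sub_zero]
      exact Int.not_odd_iff_even.1 (hiff.not.1 h)
  obtain ⟨d, hd⟩ := exists_eq_nsmul_of_dvd hB
  have hc : c = 2 • d + ∑ i ∈ B, Finsupp.single i 1 := by rw [← hd, sub_add_cancel]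
  refine ⟨d, B.map (Function.Embedding.subtype _), ?_, ?_, ?_⟩
  · intro q hq
    obtain ⟨j, -, rfl⟩ := Finset.mem_map.1 hq
    exact j.2
  · intro h
    rw [Finset.map_eq_empty] at h
    rw [hc, h, Finset.sum_empty, add_zero]
  · have hsum : ∀ S : Finset J, factorProd 0 (∑ i ∈ S, Finsupp.single i 1) =
        ∏ i ∈ S, (1 + eX i.1) := by
      intro S
      induction S using Finset.induction_on with
      | empty => simp [factorProd_zero]
      | insert a S ha ih =>
        rw [Finset.sum_insert ha, Finset.prod_insert ha, hJ.factorProd_add, ih, factorProd_single]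
        simp
    rw [algebraMap_oneAddProd, Finset.prod_map, hc, hJ.factorProd_add, hJ.factorProd_nsmul, hsum]
    rfl

lemma IsAdmissible.dvd_of_eX_eq (hJ : IsAdmissible J) (n : ℕ) {α : V →₀ ℚ} {u : BaseField V}
    (hu : u ∈ cubeField V) {c : J →₀ ℤ} (h : eX α = u ^ 2 ^ n * factorProd 0 c) :
    ∀ j, ((2 ^ n : ℕ) : ℤ) ∣ c j := by
  induction n generalizing α c with
  | zero => simp
  | succ n ih =>
    obtain ⟨d, A, hA, hA0, hc⟩ := hJ.exists_factorProd_eq c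
    have hu0 : u ≠ 0 := by
      rintro rfl
      rw [zero_pow (by positivity), zero_mul] at h
      exact eX_ne_zero _ h
    have hd0 := hJ.factorProd_ne_zero 0 d
    have hsq : algebraMap _ (BaseField V) (AddMonoidAlgebra.single (-α) 1 * oneAddProd A) =
        ((u ^ 2 ^ n * factorProd 0 d)⁻¹) ^ 2 := by
      rw [map_mul,
        show algebraMap _ (BaseField V) (AddMonoidAlgebra.single (-α) (1 : ZMod 2)) =
          eX (-α) from rfl,
        eX_neg, inv_mul_eq_iff_eq_mul₀ (eX_ne_zero _), h, hc, pow_succ 2 n, pow_mul]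
      field_simp
    have hmem : (u ^ 2 ^ n * factorProd 0 d)⁻¹ ∈ cubeField V :=
      inv_mem (mul_mem (pow_mem hu _) (hJ.factorProd_mem d))
    have hAdeg : ∀ q ∈ A, 0 < q.degree := fun q hq => hJ.degree_pos q (hA q hq)
    have hα : -α ∈ squareLattice V := by
      refine coeff_eq_zero_of_eq_sq hmem hsq ?_
      rw [AddMonoidAlgebra.coeff_single_mul_apply, neg_neg, add_neg_cancel, oneAddProd,
        coeff_zero_prod_one_add hAdeg]
      simp
    have hAe : A = ∅ := by
      by_contra hne
      obtain ⟨q, hq, hq1⟩ := exists_coeff_prod_one_add_eq_one hAdeg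
        (Finset.nonempty_iff_ne_empty.2 hne)
      have : -α + q ∈ squareLattice V := by
        refine coeff_eq_zero_of_eq_sq hmem hsq ?_
        rw [AddMonoidAlgebra.coeff_single_mul_apply, neg_neg, add_neg_cancel_left, oneAddProd, hq1]
        simp
      exact hJ.notMem q (hA q hq) (((squareLattice V).add_mem_cancel_left hα).1 this)
    obtain ⟨β, hβ, hβα⟩ := AddSubgroup.mem_map.1 ((squareLattice V).neg_mem hα)
    rw [neg_neg] at hβα
    have hcd := hA0 hAe
    have e : eX β = u ^ 2 ^ n * factorProd 0 d := by
      apply frobenius_inj (BaseField V) 2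
      simp only [frobenius_def]
      rw [eX_pow, mul_pow, ← pow_mul, ← pow_succ, ← hJ.factorProd_nsmul, ← hcd, ← h]
      exact congrArg eX hβα
    intro j
    rw [hcd, pow_succ, mul_comm, Nat.cast_mul, Finsupp.smul_apply, nsmul_eq_mul]
    exact mul_dvd_mul_left _ (ih e j)

lemma IsAdmissible.mem_of_one_add_eX_eq (hJ : IsAdmissible J) {α : V →₀ ℚ}
    (hα2 : α ∉ squareLattice V) {u : BaseField V} (hu : u ∈ cubeField V)
    {c : J →₀ ℤ} (h : 1 + eX α = u ^ 2 * factorProd 0 c) : α ∈ J := by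
  classical
  obtain ⟨d, A, hA, -, hc⟩ := hJ.exists_factorProd_eq c
  by_contra hαJ
  have hαA : α ∉ A := fun h => hαJ (hA α h)
  have hAdeg : ∀ q ∈ A, 0 < q.degree := fun q hq => hJ.degree_pos q (hA q hq)
  have hAmem : algebraMap _ (BaseField V) (oneAddProd A) ∈ cubeField V := by
    rw [algebraMap_oneAddProd]
    exact prod_mem fun q hq =>
      add_mem (one_mem _) (eX_mem_cubeField.2 (hJ.mem q (hA q hq)))
  have hins : oneAddProd (insert α A) = (1 + AddMonoidAlgebra.single α 1) * oneAddProd A :=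
    Finset.prod_insert hαA
  have hsq : algebraMap _ (BaseField V) (oneAddProd (insert α A)) =
      (u * factorProd 0 d * algebraMap _ (BaseField V) (oneAddProd A)) ^ 2 := by
    rw [hins, map_mul, map_add, map_one,
      show algebraMap _ (BaseField V) (AddMonoidAlgebra.single α (1 : ZMod 2)) = eX α from rfl,
      h, hc]
    ring
  have hmem : u * factorProd 0 d * algebraMap _ (BaseField V) (oneAddProd A) ∈ cubeField V :=
    mul_mem (mul_mem hu (hJ.factorProd_mem d)) hAmem
  by_cases hdeg : 0 < α.degree
  · obtain ⟨q, hq, hq1⟩ := exists_coeff_prod_one_add_eq_one (Q := insert α A) (by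
      intro q hq
      rcases Finset.mem_insert.1 hq with rfl | hq
      · exact hdeg
      · exact hAdeg q hq) (Finset.insert_nonempty _ _)
    have : q ∈ squareLattice V := coeff_eq_zero_of_eq_sq hmem hsq (by
      rw [oneAddProd, hq1]; exact one_ne_zero)
    rcases Finset.mem_insert.1 hq with rfl | hq
    · exact hα2 this
    · exact hJ.notMem q (hA q hq) this
  · have hα0 : α ≠ 0 := by rintro rfl; exact hα2 (zero_mem _)
    refine hα2 (coeff_eq_zero_of_eq_sq hmem hsq ?_)
    rw [hins, add_mul, one_mul, AddMonoidAlgebra.coeff_add, Finsupp.add_apply,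
      AddMonoidAlgebra.coeff_single_mul_apply, neg_add_cancel, oneAddProd,
      coeff_zero_prod_one_add hAdeg,
      coeff_prod_one_add_of_degree_nonpos hAdeg (not_lt.1 hdeg) hα0]
    simp

end Factors

section RootsOfUnity

variable {k : Type} [Field k] {ι : Type} {F : Type} [Field F]
  [Algebra (AddMonoidAlgebra k (ι →₀ ℚ)) F] [IsFractionRing (AddMonoidAlgebra k (ι →₀ ℚ)) F]

lemma algebraMap_single_inj {σ τ : ι →₀ ℚ} {a b : k} (ha : a ≠ 0)
    (h : algebraMap (AddMonoidAlgebra k (ι →₀ ℚ)) F (AddMonoidAlgebra.single σ a) =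
      algebraMap (AddMonoidAlgebra k (ι →₀ ℚ)) F (AddMonoidAlgebra.single τ b)) :
    σ = τ ∧ a = b := by
  have h := congrArg AddMonoidAlgebra.coeff (IsFractionRing.injective _ _ h)
  exact ((Finsupp.single_eq_single_iff _ _ _ _).1 h).resolve_right fun h => ha h.1

lemma smul_eq_zero_of_pow {m : ℕ} (hm : m ≠ 0) {τ : ι →₀ ℚ} (h : m • τ = 0) : τ = 0 :=
  (smul_eq_zero.1 h).resolve_left hm

end RootsOfUnity

lemma eq_one_of_pow_eq_one (k : Type) [Field k] [CharP k 2] (ι : Type) {F : Type} [Field F]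
    [Algebra (AddMonoidAlgebra k (ι →₀ ℚ)) F] [IsFractionRing (AddMonoidAlgebra k (ι →₀ ℚ)) F]
    {p : ℕ} (hp : p.Prime) {n : ℕ}
    (hk : ∀ c : k, c ^ p ^ n = 1 → c = 1) {z : F} (hz : z ^ p ^ n = 1) :
    z = 1 := by
  have hpn : p ^ n ≠ 0 := pow_ne_zero _ hp.ne_zero
  have hz0 : z ≠ 0 := by
    rintro rfl
    rw [zero_pow hpn] at hz
    exact zero_ne_one hz
  obtain ⟨l, hl, hl2, hpl⟩ : ∃ l : ℕ, l.Prime ∧ l ≠ 2 ∧ p ≠ l := by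
    by_cases h : p = 3
    · exact ⟨5, by norm_num, by norm_num, by lia⟩
    · exact ⟨3, by norm_num, by norm_num, h⟩
  obtain ⟨τ, c, rfl⟩ := exists_eq_single_of_divisible (k := k) (ι := ι) hl hl2 hz0 (fun m => by
    obtain ⟨u, v, huv⟩ : IsCoprime ((p : ℤ) ^ n) ((l : ℤ) ^ m) :=
      (Nat.isCoprime_iff_coprime.2 ((Nat.coprime_primes hp hl).2 hpl)).pow
    refine ⟨z ^ v, ?_⟩
    rw [← zpow_natCast, ← zpow_mul, Nat.cast_pow, eq_sub_of_add_eq' huv, zpow_sub₀ hz0, zpow_one,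
      mul_comm, zpow_mul, show z ^ ((p : ℤ) ^ n) = 1 by rw [← hz, ← zpow_natCast]; push_cast; rfl,
      one_zpow, div_one])
  rw [← map_pow, AddMonoidAlgebra.single_pow,
    ← map_one (algebraMap (AddMonoidAlgebra k (ι →₀ ℚ)) F), AddMonoidAlgebra.one_def] at hz
  obtain ⟨h1, h2⟩ := algebraMap_single_inj one_ne_zero hz.symm
  rw [smul_eq_zero_of_pow hpn h1.symm, hk c h2.symm, ← AddMonoidAlgebra.one_def, map_one]

/-- The nonzero elements with `p ^ n`-th roots for all `n`. -/
def IsDivisible {K : Type} [Field K] (p : ℕ) (x : K) : Prop :=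
  x ≠ 0 ∧ ∀ n : ℕ, ∃ w, w ^ p ^ n = x

lemma IsDivisible.map {K L : Type} [Field K] [Field L] {p : ℕ} {x : K} (h : IsDivisible p x)
    (f : K →+* L) : IsDivisible p (f x) := by
  refine ⟨by simpa using h.1, fun n => ?_⟩
  obtain ⟨w, hw⟩ := h.2 n
  exact ⟨f w, by rw [← map_pow, hw]⟩

lemma isDivisible_root {K : Type} [Field K] {p : ℕ} (hp : p ≠ 0)
    (hK : ∀ n, ∀ c : K, c ^ p ^ n = 1 → c = 1) {x : K}
    (hx : IsDivisible p x) {n : ℕ} {w : K} (hw : w ^ p ^ n = x) : IsDivisible p w := by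
  have hw0 : w ≠ 0 := by
    rintro rfl
    rw [zero_pow (pow_ne_zero _ hp)] at hw
    exact hx.1 hw.symm
  refine ⟨hw0, fun m => ?_⟩
  obtain ⟨v, hv⟩ := hx.2 (n + m)
  refine ⟨v, ?_⟩
  have : (v ^ p ^ m / w) ^ p ^ n = 1 := by
    rw [div_pow, hw, ← pow_mul, ← pow_add, add_comm, hv, div_self hx.1]
  exact (div_eq_one_iff_eq hw0).1 (hK n _ this)

section BigField

variable {V : Type} {J : Set (V →₀ ℚ)}

lemma BaseField.eq_one_of_pow_eq_one {p : ℕ} (hp : p.Prime) (n : ℕ) (c : BaseField V)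
    (hc : c ^ p ^ n = 1) : c = 1 := by
  refine FriedKollar.eq_one_of_pow_eq_one (ZMod 2) V hp (fun c hc => ?_) hc
  rcases (by decide : ∀ c : ZMod 2, c = 0 ∨ c = 1) c with rfl | rfl
  · rw [zero_pow (pow_ne_zero _ hp.ne_zero)] at hc
    exact absurd hc zero_ne_one
  · rfl

lemma exists_eq_eX_of_isDivisible {p : ℕ} (hp : p.Prime) (hp2 : p ≠ 2) {u : BaseField V}
    (hu : IsDivisible p u) : ∃ α, u = eX α := by
  obtain ⟨α, c, rfl⟩ := exists_eq_single_of_divisible (k := ZMod 2) (ι := V) hp hp2 hu.1 hu.2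
  refine ⟨α, ?_⟩
  rcases (by decide : ∀ c : ZMod 2, c = 0 ∨ c = 1) c with rfl | rfl
  · exact absurd (by simp) hu.1
  · rfl

/-- The field of rational functions over `BaseField V` in all rational powers of variables
indexed by `J`. -/
abbrev BigField (J : Set (V →₀ ℚ)) : Type :=
  FractionRing (AddMonoidAlgebra (BaseField V) (J →₀ ℚ))

instance : CharP (BigField J) 2 := charP_fractionRing _ _

/-- The term with coefficient `u` and exponent vector `β`. -/
def term (u : BaseField V) (β : J →₀ ℚ) : BigField J :=
  algebraMap (AddMonoidAlgebra (BaseField V) (J →₀ ℚ)) _ (AddMonoidAlgebra.single β u)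

lemma term_one_zero : term (1 : BaseField V) (0 : J →₀ ℚ) = 1 := by
  rw [term, ← AddMonoidAlgebra.one_def, map_one]

lemma term_mul (u v : BaseField V) (β γ : J →₀ ℚ) :
    term u β * term v γ = term (u * v) (β + γ) := by
  rw [term, term, term, ← map_mul, AddMonoidAlgebra.single_mul_single]

lemma term_add (u v : BaseField V) (β : J →₀ ℚ) :
    term u β + term v β = term (u + v) β := by
  rw [term, term, term, ← map_add, ← AddMonoidAlgebra.single_add]

lemma term_pow (u : BaseField V) (β : J →₀ ℚ) (n : ℕ) : term u β ^ n = term (u ^ n) (n • β) := by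
  rw [term, term, ← map_pow, AddMonoidAlgebra.single_pow]

lemma term_inj {u v : BaseField V} {β γ : J →₀ ℚ} (hu : u ≠ 0) (h : term u β = term v γ) :
    β = γ ∧ u = v := algebraMap_single_inj hu h

lemma term_ne_zero {u : BaseField V} (hu : u ≠ 0) (β : J →₀ ℚ) : term u β ≠ 0 := by
  intro h
  have : term u β = term 0 β := by
    rw [h, term, AddMonoidAlgebra.single_zero, map_zero]
  exact hu (term_inj hu this).2

lemma BigField.eq_one_of_pow_eq_one {p : ℕ} (hp : p.Prime) (n : ℕ) (c : BigField J)
    (hc : c ^ p ^ n = 1) : c = 1 :=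
  FriedKollar.eq_one_of_pow_eq_one (BaseField V) J hp
    (BaseField.eq_one_of_pow_eq_one hp n) hc

lemma exists_eq_term_of_isDivisible {p : ℕ} (hp : p.Prime) (hp2 : p ≠ 2) {x : BigField J}
    (hx : IsDivisible p x) : ∃ α β, x = term (eX α) β := by
  have key : ∀ {w : BigField J}, IsDivisible p w → ∃ u β, w = term u β := by
    intro w hw
    obtain ⟨β, u, h⟩ := exists_eq_single_of_divisible (k := BaseField V) (ι := J) hp hp2 hw.1 hw.2
    exact ⟨u, β, h⟩
  obtain ⟨u, β, rfl⟩ := key hx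
  have hu0 : u ≠ 0 := by
    rintro rfl
    exact hx.1 (by simp [term])
  have hu : IsDivisible p u := by
    refine ⟨hu0, fun n => ?_⟩
    obtain ⟨w, hw⟩ := hx.2 n
    obtain ⟨v, γ, rfl⟩ := key (isDivisible_root hp.ne_zero
      (BigField.eq_one_of_pow_eq_one (J := J) hp) hx hw)
    rw [term_pow] at hw
    exact ⟨v, (term_inj hu0 hw.symm).2.symm⟩
  obtain ⟨α, rfl⟩ := exists_eq_eX_of_isDivisible hp hp2 hu
  exact ⟨α, β, rfl⟩

lemma exists_factorProd_lift {N : ℕ} {c : J →₀ ℤ} {γ : J →₀ ℚ}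
    (h : ∀ j, γ j - c j / 2 ^ N ∈ zInv 5) (n : ℕ) :
    ∃ d : J →₀ ℤ, factorProd (N + n) d = factorProd N c ∧
      ∀ j, γ j - d j / 2 ^ (N + n) ∈ zInv 5 := by
  refine ⟨(2 ^ n : ℕ) • c, factorProd_add_nsmul N n c, fun j => ?_⟩
  convert h j using 2
  rw [Finsupp.smul_apply, nsmul_eq_mul, pow_add]
  push_cast
  field_simp

/-- The coefficients allowed at the exponent `γ`. -/
def weight (hJ : IsAdmissible J) (γ : J →₀ ℚ) : AddSubgroup (BaseField V) where
  carrier := {u | u = 0 ∨ ∃ (N : ℕ) (c : J →₀ ℤ), ∃ k ∈ cubeField V, u = k * factorProd N c ∧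
    ∀ j, γ j - c j / 2 ^ N ∈ zInv 5}
  zero_mem' := Or.inl rfl
  add_mem' := by
    rintro u v (rfl | ⟨N, c, k, hk, rfl, hc⟩) (rfl | ⟨N', c', k', hk', rfl, hc'⟩)
    · exact Or.inl (add_zero 0)
    · exact Or.inr ⟨N', c', k', hk', zero_add _, hc'⟩
    · exact Or.inr ⟨N, c, k, hk, add_zero _, hc⟩
    · obtain ⟨d, hd, hdγ⟩ := exists_factorProd_lift hc N'
      obtain ⟨d', hd', hdγ'⟩ := exists_factorProd_lift hc' N
      rw [add_comm N' N] at hd' hdγ'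
      obtain ⟨e, he⟩ : ∃ e : J →₀ ℤ, d - d' = (2 ^ (N + N') : ℕ) • e := by
        refine exists_eq_nsmul_of_dvd fun j => ?_
        have h1 := sub_mem (hdγ' j) (hdγ j)
        have h2 : (γ j - d' j / 2 ^ (N + N') - (γ j - d j / 2 ^ (N + N'))) * (2 : ℕ) ^ (N + N') =
            ((d - d') j : ℤ) := by
          rw [Finsupp.sub_apply]
          push_cast
          field_simp
          ring
        obtain ⟨b, hb⟩ := exists_int_of_mem_zInv (by norm_num) h1 h2
        rw [hb] at h2
        exact ⟨b, by rw [mul_comm]; exact_mod_cast h2.symm⟩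
      refine Or.inr ⟨N + N', d', k * factorProd 0 e + k',
        add_mem (mul_mem hk (hJ.factorProd_mem e)) hk', ?_, hdγ'⟩
      have : factorProd N c = factorProd 0 e * factorProd (N + N') d' := by
        rw [← hd, ← factorProd_nsmul_self (N + N') e, ← he, ← hJ.factorProd_add, sub_add_cancel]
      rw [this, ← hd']
      ring
  neg_mem' := by
    rintro u (rfl | ⟨N, c, k, hk, rfl, hc⟩)
    · exact Or.inl neg_zero
    · exact Or.inr ⟨N, c, -k, neg_mem hk, by ring, hc⟩

lemma mem_weight_of_mem_cubeField (hJ : IsAdmissible J) {γ : J →₀ ℚ} (hγ : γ ∈ zInvLattice 5 J)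
    {k : BaseField V} (hk : k ∈ cubeField V) : k ∈ weight hJ γ := by
  refine Or.inr ⟨0, 0, k, hk, by rw [factorProd_zero, mul_one], fun j => ?_⟩
  simpa using hγ j

lemma mul_mem_weight (hJ : IsAdmissible J) {γ δ : J →₀ ℚ} {u v : BaseField V}
    (hu : u ∈ weight hJ γ) (hv : v ∈ weight hJ δ) : u * v ∈ weight hJ (γ + δ) := by
  rcases hu with (rfl | ⟨N, c, k, hk, rfl, hc⟩)
  · exact Or.inl (zero_mul _)
  rcases hv with (rfl | ⟨N', c', k', hk', rfl, hc'⟩)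
  · exact Or.inl (mul_zero _)
  obtain ⟨d, hd, hdγ⟩ := exists_factorProd_lift hc N'
  obtain ⟨d', hd', hdγ'⟩ := exists_factorProd_lift hc' N
  rw [add_comm N' N] at hd' hdγ'
  refine Or.inr ⟨N + N', d + d', k * k', mul_mem hk hk', ?_, fun j => ?_⟩
  · rw [hJ.factorProd_add, hd, hd']
    ring
  · convert add_mem (hdγ j) (hdγ' j) using 1
    simp only [Finsupp.add_apply]
    push_cast
    ring

lemma inv_mem_weight (hJ : IsAdmissible J) {γ : J →₀ ℚ} {u : BaseField V}
    (hu : u ∈ weight hJ γ) : u⁻¹ ∈ weight hJ (-γ) := by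
  rcases hu with (rfl | ⟨N, c, k, hk, rfl, hc⟩)
  · exact Or.inl inv_zero
  refine Or.inr ⟨N, -c, k⁻¹, inv_mem hk, ?_, fun j => ?_⟩
  · rw [hJ.factorProd_neg, mul_inv]
  · convert neg_mem (hc j) using 1
    simp only [Finsupp.neg_apply]
    push_cast
    ring

/-- The generators of `markedField J`. -/
inductive IsGenerator (J : Set (V →₀ ℚ)) : BigField J → Prop
  | vertex (v : V) (n : ℕ) : IsGenerator J (term (eX (Finsupp.single v (1 / 3 ^ n))) 0)
  | mark (j : J) (n : ℕ) : IsGenerator J (term 1 (Finsupp.single j (1 / 5 ^ n)))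
  | link (j : J) (n : ℕ) : IsGenerator J
      (term (1 + eX (((2 : ℚ) ^ n)⁻¹ • j.1)) (Finsupp.single j (1 / 2 ^ n)))

/-- The field in which the vertex variables are infinitely `3`-divisible, the marks `t_m` for
`m ∈ J` are infinitely `5`-divisible and the products `t_m * (1 + e^m)` are infinitely
`2`-divisible. -/
def markedField (J : Set (V →₀ ℚ)) : Subfield (BigField J) :=
  Subfield.closure {x | IsGenerator J x}

lemma mem_weight_of_term_mem (hJ : IsAdmissible J) {u : BaseField V} {β : J →₀ ℚ}
    (h : term u β ∈ markedField J) : u ∈ weight hJ β := by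
  classical
  have h1 : (1 : BaseField V) ∈ weight hJ 0 :=
    mem_weight_of_mem_cubeField hJ (zero_mem _) (one_mem _)
  have hle : markedField J ≤ Subfield.closure
      (algebraMap (AddMonoidAlgebra (BaseField V) (J →₀ ℚ)) (BigField J) ''
        gradedSubring (weight hJ) h1 (mul_mem_weight hJ)) := by
    have key : ∀ (v : BaseField V) (γ : J →₀ ℚ), v ∈ weight hJ γ → term v γ ∈ Subfield.closure
        (algebraMap (AddMonoidAlgebra (BaseField V) (J →₀ ℚ)) (BigField J) ''
        gradedSubring (weight hJ) h1 (mul_mem_weight hJ)) := by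
      intro v γ hv
      refine Subfield.subset_closure ⟨_, fun i => ?_, rfl⟩
      rw [AddMonoidAlgebra.coeff_single, Finsupp.single_apply]
      split_ifs with hi
      · rwa [← hi]
      · exact zero_mem _
    refine Subfield.closure_le.2 ?_
    rintro x (⟨v, n⟩ | ⟨j, n⟩ | ⟨j, n⟩)
    · refine key _ _ (mem_weight_of_mem_cubeField hJ (zero_mem _) (eX_mem_cubeField.2 ?_))
      refine single_mem_zInvLattice v ?_
      simpa using div_pow_mem_zInv (by norm_num) (intCast_mem_zInv 3 1) n
    · refine key _ _ (mem_weight_of_mem_cubeField hJ ?_ (one_mem _))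
      refine single_mem_zInvLattice j ?_
      simpa using div_pow_mem_zInv (by norm_num) (intCast_mem_zInv 5 1) n
    · refine key _ _ (Or.inr ⟨n, Finsupp.single j 1, 1, one_mem _, ?_, fun i => ?_⟩)
      · rw [factorProd_single, one_mul, zpow_one]
      · convert zero_mem (zInv 5)
        rw [Finsupp.single_apply, Finsupp.single_apply]
        split_ifs <;> simp
  exact mem_of_single_mem_closure (weight hJ) h1 (mul_mem_weight hJ) (inv_mem_weight hJ) (hle h)

lemma exists_nsmul_eq_of_mem {N : ℕ} {c : J →₀ ℤ} (h : ∀ j, (c j : ℚ) / 2 ^ N ∈ zInv 5) :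
    ∃ d : J →₀ ℤ, c = (2 ^ N : ℕ) • d := by
  refine exists_eq_nsmul_of_dvd fun j => ?_
  have h2 : (c j : ℚ) / 2 ^ N * (2 : ℕ) ^ N = (c j : ℤ) := by
    push_cast
    field_simp
  obtain ⟨b, hb⟩ := exists_int_of_mem_zInv (by norm_num) (h j) h2
  rw [hb] at h2
  exact ⟨b, by rw [mul_comm]; exact_mod_cast h2.symm⟩

lemma mem_lattice_of_term_mem (hJ : IsAdmissible J) {α : V →₀ ℚ} {β : J →₀ ℚ}
    (h : term (eX α) β ∈ markedField J) : α ∈ zInvLattice 3 V ∧ β ∈ zInvLattice 5 J := by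
  rcases mem_weight_of_term_mem hJ h with h0 | ⟨N, c, k, hk, e, hc⟩
  · exact absurd h0 (eX_ne_zero α)
  have e2 := congrArg (· ^ 2 ^ N) e
  simp only [mul_pow, hJ.factorProd_pow, eX_pow] at e2
  obtain ⟨d, rfl⟩ := exists_eq_nsmul_of_dvd (hJ.dvd_of_eX_eq N hk e2)
  rw [factorProd_nsmul_self] at e
  refine ⟨eX_mem_cubeField.1 (e ▸ mul_mem hk (hJ.factorProd_mem d)), fun j => ?_⟩
  have := hc j
  rw [Finsupp.smul_apply, nsmul_eq_mul] at this
  push_cast at this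
  rw [mul_div_cancel_left₀ _ (by positivity)] at this
  simpa using add_mem this (intCast_mem_zInv 5 (d j))

end BigField

lemma zInvLattice_le {p : ℕ} (hp : p ≠ 0) {ι : Type} {S : AddSubgroup (ι →₀ ℚ)}
    (h : ∀ i (n : ℕ), Finsupp.single i (1 / (p : ℚ) ^ n) ∈ S) : zInvLattice p ι ≤ S := by
  intro α hα
  rw [← Finsupp.sum_single α]
  refine sum_mem fun i _ => ?_
  obtain ⟨n, a, e⟩ := hα i
  have hp : (p : ℚ) ≠ 0 := by exact_mod_cast hp
  have : Finsupp.single i (α i) = a • Finsupp.single i (1 / (p : ℚ) ^ n) := by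
    rw [Finsupp.smul_single, zsmul_eq_mul, ← e]
    congr 1
    field_simp
  rw [this]
  exact zsmul_mem (h i n) a

lemma div_pow_mem_zInvLattice {p : ℕ} (hp : p ≠ 0) {ι : Type} {α : ι →₀ ℚ}
    (hα : α ∈ zInvLattice p ι) (n : ℕ) : ((p : ℚ) ^ n)⁻¹ • α ∈ zInvLattice p ι := by
  intro i
  rw [Finsupp.smul_apply, smul_eq_mul, mul_comm, ← div_eq_mul_inv]
  exact div_pow_mem_zInv hp (hα i) n

lemma nsmul_inv_smul {p : ℕ} (hp : p ≠ 0) {ι : Type} (α : ι →₀ ℚ) (n : ℕ) :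
    p ^ n • ((p : ℚ) ^ n)⁻¹ • α = α := by
  have hp : (p : ℚ) ≠ 0 := by exact_mod_cast hp
  ext i
  simp only [Finsupp.smul_apply, nsmul_eq_mul, smul_eq_mul]
  push_cast
  field_simp

lemma eq_zero_of_forall_eq_pow_nsmul {p l : ℕ} (hpl : p.Coprime l) (hp : p ≠ 0) (hl : 1 < l)
    {ι : Type} {α : ι →₀ ℚ} (h : ∀ n : ℕ, ∃ β ∈ zInvLattice p ι, l ^ n • β = α) : α = 0 := by
  ext i
  refine eq_zero_of_div_pow_mem_zInv hpl hp hl fun n => ?_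
  obtain ⟨β, hβ, rfl⟩ := h n
  convert hβ i
  rw [Finsupp.smul_apply, nsmul_eq_mul]
  push_cast
  rw [mul_div_cancel_left₀]
  exact pow_ne_zero _ (by exact_mod_cast (by lia : l ≠ 0))

section MarkedField

variable {V : Type} {J : Set (V →₀ ℚ)}

lemma term_eX_mem {α : V →₀ ℚ} (hα : α ∈ zInvLattice 3 V) :
    term (eX α) (0 : J →₀ ℚ) ∈ markedField J := by
  let S : AddSubgroup (V →₀ ℚ) :=
    { carrier := {α | term (eX α) (0 : J →₀ ℚ) ∈ markedField J}
      zero_mem' := by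
        change term (eX 0) (0 : J →₀ ℚ) ∈ markedField J
        rw [eX_zero, term_one_zero]
        exact one_mem _
      add_mem' := by
        intro a b ha hb
        change term (eX (a + b)) (0 : J →₀ ℚ) ∈ markedField J
        rw [eX_add, ← add_zero (0 : J →₀ ℚ), ← term_mul]
        exact mul_mem ha hb
      neg_mem' := by
        intro a ha
        change term (eX (-a)) (0 : J →₀ ℚ) ∈ markedField J
        have : term (eX (-a)) (0 : J →₀ ℚ) = (term (eX a) 0)⁻¹ := by
          apply eq_inv_of_mul_eq_one_left
          rw [term_mul, ← eX_add, neg_add_cancel, eX_zero, add_zero, term_one_zero]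
        rw [this]
        exact inv_mem ha }
  exact zInvLattice_le (S := S) (p := 3) (by norm_num)
    (fun v n => Subfield.subset_closure (IsGenerator.vertex v n)) hα

lemma term_one_mem {β : J →₀ ℚ} (hβ : β ∈ zInvLattice 5 J) : term 1 β ∈ markedField J := by
  let S : AddSubgroup (J →₀ ℚ) :=
    { carrier := {β | term 1 β ∈ markedField J}
      zero_mem' := by
        change term 1 (0 : J →₀ ℚ) ∈ markedField J
        rw [term_one_zero]
        exact one_mem _
      add_mem' := by
        intro a b ha hb
        change term 1 (a + b) ∈ markedField J
        rw [← mul_one (1 : BaseField V), ← term_mul]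
        exact mul_mem ha hb
      neg_mem' := by
        intro a ha
        change term 1 (-a) ∈ markedField J
        have : term (1 : BaseField V) (-a) = (term 1 a)⁻¹ := by
          apply eq_inv_of_mul_eq_one_left
          rw [term_mul, neg_add_cancel, one_mul, term_one_zero]
        rw [this]
        exact inv_mem ha }
  exact zInvLattice_le (S := S) (p := 5) (by norm_num)
    (fun v n => Subfield.subset_closure (IsGenerator.mark v n)) hβ

lemma exists_roots_of_isDivisible (hJ : IsAdmissible J) {p : ℕ} (hp : p.Prime) (hp2 : p ≠ 2)
    {x : markedField J} (hx : IsDivisible p x) :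
    ∃ α β, (x : BigField J) = term (eX α) β ∧ α ∈ zInvLattice 3 V ∧ β ∈ zInvLattice 5 J ∧
      (∀ n : ℕ, ∃ γ ∈ zInvLattice 3 V, p ^ n • γ = α) ∧
      ∀ n : ℕ, ∃ γ ∈ zInvLattice 5 J, p ^ n • γ = β := by
  have hx' := hx.map (markedField J).subtype
  obtain ⟨α, β, e⟩ := exists_eq_term_of_isDivisible hp hp2 hx'
  change (x : BigField J) = _ at e
  have key : ∀ n : ℕ, ∃ γ ∈ zInvLattice 3 V, ∃ δ ∈ zInvLattice 5 J,
      p ^ n • γ = α ∧ p ^ n • δ = β := by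
    intro n
    obtain ⟨w, hw⟩ := hx.2 n
    have hw' : (w : BigField J) ^ p ^ n = x := congrArg Subtype.val hw
    obtain ⟨γ, δ, hγ⟩ := exists_eq_term_of_isDivisible hp hp2
      (isDivisible_root hp.ne_zero (BigField.eq_one_of_pow_eq_one (J := J) hp) hx' hw')
    have h := mem_lattice_of_term_mem hJ (hγ ▸ w.2)
    refine ⟨γ, h.1, δ, h.2, ?_⟩
    rw [hγ, term_pow, eX_pow] at hw'
    obtain ⟨h1, h2⟩ := term_inj (eX_ne_zero _) (hw'.trans e)
    exact ⟨eX_injective h2, h1⟩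
  have hm := mem_lattice_of_term_mem hJ (e ▸ x.2)
  refine ⟨α, β, e, hm.1, hm.2, fun n => ?_, fun n => ?_⟩ <;>
    obtain ⟨γ, hγ, δ, hδ, h1, h2⟩ := key n
  exacts [⟨γ, hγ, h1⟩, ⟨δ, hδ, h2⟩]

lemma isDivisible_three_iff (hJ : IsAdmissible J) {x : markedField J} :
    IsDivisible 3 x ↔ ∃ α ∈ zInvLattice 3 V, (x : BigField J) = term (eX α) 0 := by
  constructor
  · intro hx
    obtain ⟨α, β, e, hα, -, -, hβ⟩ := exists_roots_of_isDivisible hJ (by norm_num) (by norm_num) hx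
    rw [eq_zero_of_forall_eq_pow_nsmul (by norm_num) (by norm_num) (by norm_num) hβ] at e
    exact ⟨α, hα, e⟩
  · rintro ⟨α, hα, e⟩
    refine ⟨fun h => ?_, fun n => ?_⟩
    · rw [h] at e
      exact term_ne_zero (eX_ne_zero α) (0 : J →₀ ℚ) e.symm
    · refine ⟨⟨_, term_eX_mem (div_pow_mem_zInvLattice (by norm_num) hα n)⟩, Subtype.ext ?_⟩
      change term _ _ ^ _ = _
      rw [e, term_pow, eX_pow, nsmul_inv_smul (by norm_num), smul_zero]

lemma isDivisible_five_iff (hJ : IsAdmissible J) {x : markedField J} :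
    IsDivisible 5 x ↔ ∃ β ∈ zInvLattice 5 J, (x : BigField J) = term 1 β := by
  constructor
  · intro hx
    obtain ⟨α, β, e, -, hβ, hα, -⟩ := exists_roots_of_isDivisible hJ (by norm_num) (by norm_num) hx
    rw [eq_zero_of_forall_eq_pow_nsmul (by norm_num) (by norm_num) (by norm_num) hα, eX_zero] at e
    exact ⟨β, hβ, e⟩
  · rintro ⟨β, hβ, e⟩
    refine ⟨fun h => ?_, fun n => ?_⟩
    · rw [h] at e
      exact term_ne_zero one_ne_zero β e.symm
    · refine ⟨⟨_, term_one_mem (div_pow_mem_zInvLattice (by norm_num) hβ n)⟩, Subtype.ext ?_⟩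
      change term _ _ ^ _ = _
      rw [e, term_pow, one_pow, nsmul_inv_smul (by norm_num)]

lemma link_pow (j : J) (n : ℕ) :
    term (1 + eX (((2 : ℚ) ^ n)⁻¹ • j.1)) (Finsupp.single j (1 / 2 ^ n)) ^ 2 ^ n =
      term (1 + eX j.1) (Finsupp.single j 1) := by
  have h := nsmul_inv_smul (p := 2) (by norm_num) j.1 n
  push_cast at h
  rw [term_pow, one_add_eX_pow, h, Finsupp.smul_single, nsmul_eq_mul]
  push_cast
  rw [mul_one_div_cancel (by positivity)]

lemma BigField.eq_of_pow_eq {p : ℕ} (hp : p.Prime) {n : ℕ} {a b : BigField J}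
    (h : a ^ p ^ n = b ^ p ^ n) : a = b := by
  have hpn : p ^ n ≠ 0 := pow_ne_zero _ hp.ne_zero
  rcases eq_or_ne b 0 with rfl | hb
  · rw [zero_pow hpn] at h
    exact eq_zero_of_pow_eq_zero h
  · refine (div_eq_one_iff_eq hb).1 (BigField.eq_one_of_pow_eq_one hp n _ ?_)
    rw [div_pow, h, div_self (pow_ne_zero _ hb)]

lemma IsAdmissible.exists_one_add_eX_eq (hJ : IsAdmissible J) {α : V →₀ ℚ} (hα : α ≠ 0)
    {β : J →₀ ℚ} (hβ : β ∈ zInvLattice 5 J) {w : BigField J} (hwm : w ∈ markedField J) {n : ℕ}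
    (hw : w ^ 2 ^ n = term (1 + eX α) β) :
    ∃ k ∈ cubeField V, ∃ c : J →₀ ℤ, 1 + eX α = k ^ 2 ^ n * factorProd 0 c ∧
      ∀ j, (β j - c j) / 2 ^ n ∈ zInv 5 := by
  have hα' := nsmul_inv_smul (p := 2) (by norm_num) α n
  have hβ' := nsmul_inv_smul (p := 2) (by norm_num) β n
  push_cast at hα' hβ'
  have e : w = term (1 + eX (((2 : ℚ) ^ n)⁻¹ • α)) (((2 : ℚ) ^ n)⁻¹ • β) := by
    apply BigField.eq_of_pow_eq Nat.prime_two (n := n)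
    rw [hw, term_pow, one_add_eX_pow, hα', hβ']
  rcases mem_weight_of_term_mem hJ (e ▸ hwm) with h0 | ⟨N, c, k, hk, ek, hc⟩
  · exact absurd h0 (one_add_eX_ne_zero (smul_ne_zero (by positivity) hα))
  obtain ⟨d, hd, hdβ⟩ := exists_factorProd_lift hc n
  obtain ⟨b, rfl⟩ : ∃ b : J →₀ ℤ, d = (2 ^ N : ℕ) • b := by
    refine exists_nsmul_eq_of_mem fun j => ?_
    have := sub_mem (hβ j) (nsmul_mem (hdβ j) (2 ^ n))
    convert this using 1
    rw [Finsupp.smul_apply, nsmul_eq_mul, smul_eq_mul, pow_add]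
    push_cast
    field_simp
    ring
  rw [← hd, add_comm N n, factorProd_add_nsmul] at ek
  refine ⟨k, hk, b, ?_, fun j => ?_⟩
  · rw [← hJ.factorProd_pow n, ← mul_pow, ← ek, one_add_eX_pow, hα']
  · convert hdβ j using 1
    rw [Finsupp.smul_apply, Finsupp.smul_apply, nsmul_eq_mul, smul_eq_mul, pow_add]
    push_cast
    field_simp

lemma IsAdmissible.exists_eq_of_forall_root (hJ : IsAdmissible J) {α : V →₀ ℚ}
    (hα : α ∉ squareLattice V) {β : J →₀ ℚ} (hβ : β ∈ zInvLattice 5 J)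
    (h : ∀ n : ℕ, ∃ w ∈ markedField J, w ^ 2 ^ n = term (1 + eX α) β) :
    ∃ j : J, α = j.1 ∧ β = Finsupp.single j 1 := by
  classical
  have hα0 : α ≠ 0 := by
    rintro rfl
    exact hα (zero_mem _)
  have key : ∀ n : ℕ, ∃ k ∈ cubeField V, ∃ c : J →₀ ℤ, 1 + eX α = k ^ 2 ^ n * factorProd 0 c ∧
      ∀ j, (β j - c j) / 2 ^ n ∈ zInv 5 := by
    intro n
    obtain ⟨w, hwm, hw⟩ := h n
    exact hJ.exists_one_add_eX_eq hα0 hβ hwm hw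
  have hαJ : α ∈ J := by
    obtain ⟨k, hk, c, e, -⟩ := key 1
    rw [pow_one] at e
    exact hJ.mem_of_one_add_eX_eq hα hk e
  refine ⟨⟨α, hαJ⟩, rfl, ?_⟩
  ext j
  rw [← sub_eq_zero]
  refine eq_zero_of_div_pow_mem_zInv (p := 5) (l := 2) (by norm_num) (by norm_num) (by norm_num)
    fun n => ?_
  obtain ⟨k, hk, c, e, hc⟩ := key n
  have e1 : eX (0 : V →₀ ℚ) = k ^ 2 ^ n * factorProd 0 (c - Finsupp.single (⟨α, hαJ⟩ : J) 1) := by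
    have hne := one_add_eX_ne_zero hα0
    have hs : factorProd 0 (Finsupp.single (⟨α, hαJ⟩ : J) 1) = 1 + eX α := by
      rw [factorProd_single, pow_zero, inv_one, one_smul, zpow_one]
    apply mul_right_cancel₀ hne
    rw [mul_assoc, ← hs, ← hJ.factorProd_add, sub_add_cancel, hs, ← e, eX_zero, one_mul]
  obtain ⟨b, hb⟩ := hJ.dvd_of_eX_eq n hk e1 j
  have h2 : (c j : ℚ) - Finsupp.single (⟨α, hαJ⟩ : J) (1 : ℚ) j = 2 ^ n * b := by
    have h3 : ((c - (Finsupp.single (⟨α, hαJ⟩ : J) 1 : J →₀ ℤ)) j : ℤ) = ((2 ^ n * b : ℤ) : ℚ) := by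
      rw [hb]; push_cast; rfl
    rw [← Int.cast_two, ← Int.cast_pow, ← Int.cast_mul, ← h3]
    rw [Finsupp.sub_apply, Finsupp.single_apply, Finsupp.single_apply]
    split_ifs <;> simp
  convert add_mem (hc j) (intCast_mem_zInv 5 b) using 1
  push_cast
  field_simp
  linarith

/-- The relation between a mark `t` and the monomial `g` it marks. -/
def IsMark {K : Type} [Field K] (t g : K) : Prop :=
  IsDivisible 5 t ∧ IsDivisible 3 g ∧ (¬ ∃ h, IsDivisible 3 h ∧ h ^ 2 = g) ∧
    ∀ n : ℕ, ∃ w, w ^ 2 ^ n = t * (1 + g)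

lemma isMark_iff (hJ : IsAdmissible J) {t g : markedField J} :
    IsMark t g ↔ ∃ j : J, (t : BigField J) = term 1 (Finsupp.single j 1) ∧
      (g : BigField J) = term (eX j.1) 0 := by
  have hprod : ∀ (α : V →₀ ℚ) (β : J →₀ ℚ),
      term 1 β * (1 + term (eX α) 0) = term (1 + eX α) β := by
    intro α β
    rw [← term_one_zero, term_add, term_mul, one_mul, add_zero]
  constructor
  · rintro ⟨ht, hg, hsq, hroot⟩
    obtain ⟨β, hβ, et⟩ := (isDivisible_five_iff hJ).1 ht
    obtain ⟨α, hα, eg⟩ := (isDivisible_three_iff hJ).1 hg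
    have hα2 : α ∉ squareLattice V := by
      rintro ⟨γ, hγ, rfl⟩
      refine hsq ⟨⟨_, term_eX_mem hγ⟩, (isDivisible_three_iff hJ).2 ⟨γ, hγ, rfl⟩, Subtype.ext ?_⟩
      change term _ _ ^ 2 = _
      rw [eg, term_pow, eX_pow, smul_zero]
      rfl
    obtain ⟨j, rfl, rfl⟩ := hJ.exists_eq_of_forall_root hα2 hβ fun n => by
      obtain ⟨w, hw⟩ := hroot n
      refine ⟨w, w.2, ?_⟩
      have := congrArg Subtype.val hw
      rw [← hprod, ← et, ← eg]
      exact this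
    exact ⟨j, et, eg⟩
  · rintro ⟨j, et, eg⟩
    refine ⟨(isDivisible_five_iff hJ).2 ⟨_, single_mem_zInvLattice j ?_, et⟩,
      (isDivisible_three_iff hJ).2 ⟨_, hJ.mem _ j.2, eg⟩, ?_, fun n => ?_⟩
    · simpa using intCast_mem_zInv 5 1
    · rintro ⟨h, hh, e⟩
      obtain ⟨γ, hγ, eh⟩ := (isDivisible_three_iff hJ).1 hh
      have e := congrArg Subtype.val e
      have e : (h : BigField J) ^ 2 = g := e
      rw [eh, eg, term_pow, eX_pow] at e
      exact hJ.notMem _ j.2 ⟨γ, hγ, eX_injective (term_inj (eX_ne_zero _) e).2⟩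
    · refine ⟨⟨_, Subfield.subset_closure (IsGenerator.link j n)⟩, Subtype.ext ?_⟩
      change term _ _ ^ _ = (t : BigField J) * (1 + (g : BigField J))
      rw [link_pow, et, eg, hprod]

end MarkedField

section Graph

variable {V : Type}

lemma notMem_squareLattice {m : V →₀ ℚ} {v : V} (h : m v = 1) : m ∉ squareLattice V := by
  rintro ⟨γ, hγ, rfl⟩
  have h : γ v * (2 : ℕ) ^ 1 = (1 : ℤ) := by
    rw [← Int.cast_one] at h
    rw [pow_one, mul_comm, ← h]
    simp
  obtain ⟨b, hb⟩ := exists_int_of_mem_zInv (by norm_num) (hγ v) h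
  rw [hb] at h
  norm_cast at h
  lia

/-- The exponents marking the vertices and the edges of `Γ`. -/
def graphMarks (Γ : SimpleGraph V) : Set (V →₀ ℚ) :=
  {m | (∃ v, m = Finsupp.single v 1) ∨
    ∃ v w, Γ.Adj v w ∧ m = Finsupp.single v 1 + Finsupp.single w 1}

variable {Γ : SimpleGraph V}

lemma single_mem_graphMarks (v : V) : Finsupp.single v 1 ∈ graphMarks Γ := Or.inl ⟨v, rfl⟩

lemma one_le_degree_of_mem_graphMarks {m : V →₀ ℚ} (hm : m ∈ graphMarks Γ) : 1 ≤ m.degree := by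
  rcases hm with ⟨v, rfl⟩ | ⟨v, w, -, rfl⟩ <;> simp

lemma isAdmissible_graphMarks : IsAdmissible (graphMarks Γ) where
  degree_pos m hm := zero_lt_one.trans_le (one_le_degree_of_mem_graphMarks hm)
  mem := by
    have h : ∀ v : V, Finsupp.single v 1 ∈ zInvLattice 3 V := fun v =>
      single_mem_zInvLattice v (by simpa using intCast_mem_zInv 3 1)
    rintro m (⟨v, rfl⟩ | ⟨v, w, -, rfl⟩)
    exacts [h v, add_mem (h v) (h w)]
  notMem := by
    classical
    rintro m (⟨v, rfl⟩ | ⟨v, w, h, rfl⟩)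
    · exact notMem_squareLattice (v := v) (by simp)
    · exact notMem_squareLattice (v := v) (by simp [h.ne'])

lemma single_add_single_mem_graphMarks {v w : V} :
    Finsupp.single v 1 + Finsupp.single w 1 ∈ graphMarks Γ ↔ Γ.Adj v w := by
  refine ⟨?_, fun h => Or.inr ⟨v, w, h, rfl⟩⟩
  rintro (⟨a, h⟩ | ⟨a, b, hab, h⟩)
  · have := congrArg Finsupp.degree h
    simp at this
  · rcases (Finsupp.single_add_single_eq_single_add_single one_ne_zero one_ne_zero).1 h with
      ⟨rfl, rfl⟩ | ⟨-, rfl, rfl⟩ | ⟨h, -⟩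
    · exact hab
    · exact hab.symm
    · norm_num at h

/-- The field whose automorphism group is that of `Γ`. -/
abbrev GraphField (Γ : SimpleGraph V) : Type := markedField (graphMarks Γ)

/-- The monomial with exponent `j`. -/
def monomialOf (j : graphMarks Γ) : GraphField Γ :=
  ⟨term (eX j.1) 0, term_eX_mem (isAdmissible_graphMarks.mem _ j.2)⟩

/-- The mark of the monomial with exponent `j`. -/
def markOf (j : graphMarks Γ) : GraphField Γ :=
  ⟨term 1 (Finsupp.single j 1), term_one_mem
    (single_mem_zInvLattice j (by simpa using intCast_mem_zInv 5 1))⟩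

/-- The variable attached to a vertex. -/
def vertexVar (Γ : SimpleGraph V) (v : V) : GraphField Γ :=
  monomialOf ⟨_, single_mem_graphMarks v⟩

lemma monomialOf_injective : Function.Injective (monomialOf (Γ := Γ)) := fun _ _ h =>
  Subtype.ext (eX_injective (term_inj (eX_ne_zero _) (congrArg Subtype.val h)).2)

lemma vertexVar_injective : Function.Injective (vertexVar Γ) := fun v w h => by
  have h := congrArg Subtype.val (monomialOf_injective h)
  exact (Finsupp.single_left_inj one_ne_zero).1 h

lemma monomialOf_mul (i j : graphMarks Γ) :
    ((monomialOf i * monomialOf j : GraphField Γ) : BigField (graphMarks Γ)) =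
      term (eX (i.1 + j.1)) 0 := by
  change term _ _ * term _ _ = _
  rw [term_mul, eX_add, add_zero]

lemma monomialOf_edge {v w : V} (h : Finsupp.single v 1 + Finsupp.single w 1 ∈ graphMarks Γ) :
    monomialOf ⟨_, h⟩ = vertexVar Γ v * vertexVar Γ w :=
  Subtype.ext (monomialOf_mul ⟨_, single_mem_graphMarks v⟩ ⟨_, single_mem_graphMarks w⟩).symm

lemma isMark_graph_iff {t g : GraphField Γ} :
    IsMark t g ↔ ∃ j, t = markOf j ∧ g = monomialOf j := by
  rw [isMark_iff isAdmissible_graphMarks]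
  exact exists_congr fun j => and_congr (Subtype.ext_iff (a2 := markOf j)).symm
    (Subtype.ext_iff (a2 := monomialOf j)).symm

lemma IsDivisible.map_equiv {K : Type} [Field K] {p : ℕ} {x : K} (h : IsDivisible p x)
    (σ : K ≃+* K) : IsDivisible p (σ x) := h.map (σ : K →+* K)

lemma IsMark.map {K : Type} [Field K] {t g : K} (h : IsMark t g) (σ : K ≃+* K) :
    IsMark (σ t) (σ g) := by
  obtain ⟨h1, h2, h3, h4⟩ := h
  refine ⟨h1.map_equiv σ, h2.map_equiv σ, ?_, fun n => ?_⟩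
  · rintro ⟨x, hx, e⟩
    exact h3 ⟨σ.symm x, hx.map_equiv σ.symm, by rw [← map_pow, e, σ.symm_apply_apply]⟩
  · obtain ⟨w, hw⟩ := h4 n
    exact ⟨σ w, by rw [← map_pow, hw, map_mul, map_add, map_one]⟩

lemma exists_apply_mark (σ : GraphField Γ ≃+* GraphField Γ) (j : graphMarks Γ) :
    ∃ i, σ (markOf j) = markOf i ∧ σ (monomialOf j) = monomialOf i :=
  isMark_graph_iff.1 ((isMark_graph_iff.2 ⟨j, rfl, rfl⟩).map σ)

lemma exists_apply_vertexVar (σ : GraphField Γ ≃+* GraphField Γ) (v : V) :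
    ∃ w, σ (vertexVar Γ v) = vertexVar Γ w := by
  obtain ⟨⟨m, hm⟩, -, h⟩ := exists_apply_mark σ ⟨_, single_mem_graphMarks v⟩
  change σ (vertexVar Γ v) = _ at h
  rcases id hm with ⟨w, rfl⟩ | ⟨a, b, -, rfl⟩
  · exact ⟨w, h⟩
  · exfalso
    rw [monomialOf_edge] at h
    obtain ⟨i, -, hi⟩ := exists_apply_mark σ.symm ⟨_, single_mem_graphMarks a⟩
    obtain ⟨j, -, hj⟩ := exists_apply_mark σ.symm ⟨_, single_mem_graphMarks b⟩
    have e : vertexVar Γ v = monomialOf i * monomialOf j := by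
      rw [← hi, ← hj, ← RingEquiv.map_mul, ← σ.symm_apply_apply (vertexVar Γ v), h]
      rfl
    have e := (congrArg Subtype.val e).trans (monomialOf_mul i j)
    have e := congrArg Finsupp.degree (eX_injective (term_inj (eX_ne_zero _) e).2)
    rw [Finsupp.degree_single, map_add] at e
    have h1 := one_le_degree_of_mem_graphMarks i.2
    have h2 := one_le_degree_of_mem_graphMarks j.2
    linarith

/-- The permutation of the vertices induced by a field automorphism. -/
def vertexMap (σ : GraphField Γ ≃+* GraphField Γ) (v : V) : V :=
  (exists_apply_vertexVar σ v).choose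

lemma apply_vertexVar (σ : GraphField Γ ≃+* GraphField Γ) (v : V) :
    σ (vertexVar Γ v) = vertexVar Γ (vertexMap σ v) := (exists_apply_vertexVar σ v).choose_spec

lemma vertexMap_one (v : V) : vertexMap (1 : GraphField Γ ≃+* GraphField Γ) v = v :=
  vertexVar_injective (apply_vertexVar _ _).symm

lemma vertexMap_mul (σ τ : GraphField Γ ≃+* GraphField Γ) (v : V) :
    vertexMap (σ * τ) v = vertexMap σ (vertexMap τ v) := by
  apply vertexVar_injective
  rw [← apply_vertexVar, ← apply_vertexVar, ← apply_vertexVar, RingAut.mul_apply]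

lemma adj_vertexMap (σ : GraphField Γ ≃+* GraphField Γ) {v w : V} (h : Γ.Adj v w) :
    Γ.Adj (vertexMap σ v) (vertexMap σ w) := by
  obtain ⟨j, -, hj⟩ := exists_apply_mark σ ⟨_, single_add_single_mem_graphMarks.2 h⟩
  rw [monomialOf_edge, RingEquiv.map_mul, apply_vertexVar, apply_vertexVar] at hj
  have e := (monomialOf_mul ⟨_, single_mem_graphMarks _⟩ ⟨_, single_mem_graphMarks _⟩).symm.trans
    (congrArg Subtype.val hj)
  have e := eX_injective (term_inj (eX_ne_zero _) e).2
  rw [← single_add_single_mem_graphMarks, e]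
  exact j.2

variable (Γ) in
/-- The action of field automorphisms on the graph. -/
def toGraphAut : (GraphField Γ ≃+* GraphField Γ) →* (Γ ≃g Γ) where
  toFun σ :=
    { toFun := vertexMap σ
      invFun := vertexMap σ⁻¹
      left_inv v := by rw [← vertexMap_mul, inv_mul_cancel, vertexMap_one]
      right_inv v := by rw [← vertexMap_mul, mul_inv_cancel, vertexMap_one]
      map_rel_iff' := by
        refine fun {v w} => ⟨fun h => ?_, adj_vertexMap σ⟩
        have := adj_vertexMap σ⁻¹ h
        change Γ.Adj (vertexMap σ⁻¹ (vertexMap σ v)) (vertexMap σ⁻¹ (vertexMap σ w)) at this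
        rwa [← vertexMap_mul, ← vertexMap_mul, inv_mul_cancel, vertexMap_one,
          vertexMap_one] at this }
  map_one' := RelIso.ext vertexMap_one
  map_mul' σ τ := RelIso.ext (vertexMap_mul σ τ)

lemma apply_eq_self_of_pow_eq {K : Type} [Field K] {σ : K ≃+* K} {x y : K} {m : ℕ}
    (hinj : ∀ {a b : K}, a ^ m = b ^ m → a = b) (hx : σ x = x) (h : y ^ m = x) : σ y = y :=
  hinj (by rw [← map_pow, h, hx])

lemma GraphField.eq_of_pow_eq {p : ℕ} (hp : p.Prime) {n : ℕ} {a b : GraphField Γ}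
    (h : a ^ p ^ n = b ^ p ^ n) : a = b :=
  Subtype.ext (BigField.eq_of_pow_eq hp (congrArg Subtype.val h))

lemma eq_one_of_vertexMap {σ : GraphField Γ ≃+* GraphField Γ} (h : ∀ v, vertexMap σ v = v) :
    σ = 1 := by
  have h1 : ∀ v, σ (vertexVar Γ v) = vertexVar Γ v := fun v => by rw [apply_vertexVar, h]
  have h2 : ∀ j, σ (monomialOf j) = monomialOf j := by
    rintro ⟨m, ⟨v, rfl⟩ | ⟨v, w, hvw, rfl⟩⟩
    · exact h1 v
    · have hm := monomialOf_edge (single_add_single_mem_graphMarks.2 hvw)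
      exact hm ▸ (RingEquiv.map_mul σ _ _).trans (by rw [h1, h1])
  have h3 : ∀ j, σ (markOf j) = markOf j := by
    intro j
    obtain ⟨i, hi, hi'⟩ := exists_apply_mark σ j
    rw [hi, monomialOf_injective (hi'.symm.trans (h2 j))]
  have hle : markedField (graphMarks Γ) ≤
      ((σ : GraphField Γ →+* GraphField Γ).eqLocusField (RingHom.id _)).map
        (markedField (graphMarks Γ)).subtype := by
    refine Subfield.closure_le.2 fun x hx => ?_
    refine Subfield.mem_map.2 ⟨⟨x, Subfield.subset_closure hx⟩, ?_, rfl⟩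
    change σ _ = _
    rcases hx with ⟨v, n⟩ | ⟨j, n⟩ | ⟨j, n⟩
    · refine apply_eq_self_of_pow_eq (GraphField.eq_of_pow_eq Nat.prime_three (n := n)) (h1 v)
        (Subtype.ext ?_)
      change term _ _ ^ _ = term _ _
      rw [term_pow, eX_pow, smul_zero, Finsupp.smul_single, nsmul_eq_mul]
      push_cast
      rw [mul_one_div_cancel (by positivity)]
    · refine apply_eq_self_of_pow_eq (GraphField.eq_of_pow_eq Nat.prime_five (n := n)) (h3 j)
        (Subtype.ext ?_)
      change term _ _ ^ _ = term _ _
      rw [term_pow, one_pow, Finsupp.smul_single, nsmul_eq_mul]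
      push_cast
      rw [mul_one_div_cancel (by positivity)]
    · refine apply_eq_self_of_pow_eq (x := markOf j * (1 + monomialOf j))
        (GraphField.eq_of_pow_eq Nat.prime_two (n := n))
        (by rw [RingEquiv.map_mul, RingEquiv.map_add, RingEquiv.map_one, h2, h3]) (Subtype.ext ?_)
      change term _ _ ^ _ = term _ _ * (1 + term _ _)
      rw [link_pow, ← term_one_zero, term_add, term_mul, one_mul, add_zero]
  refine RingEquiv.ext fun x => ?_
  obtain ⟨y, hy, e⟩ := Subfield.mem_map.1 (hle x.2)
  rw [← show y = x from Subtype.ext e]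
  exact hy

end Graph

section Action

variable {V : Type}

/-- The automorphism of `BaseField V` permuting the variables. -/
def baseEquiv (π : V ≃ V) : BaseField V ≃+* BaseField V :=
  IsFractionRing.ringEquivOfRingEquiv
    (AddMonoidAlgebra.mapDomainRingEquiv (ZMod 2) (Finsupp.domCongr π : (V →₀ ℚ) ≃+ (V →₀ ℚ)))

lemma baseEquiv_eX (π : V ≃ V) (α : V →₀ ℚ) : baseEquiv π (eX α) = eX (Finsupp.domCongr π α) := by
  rw [baseEquiv, eX, IsFractionRing.ringEquivOfRingEquiv_algebraMap,
    AddMonoidAlgebra.mapDomainRingEquiv_single, eX]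

/-- The automorphism of `BigField J` given by an automorphism of the coefficients and a
permutation of the variables. -/
def bigEquiv {J : Set (V →₀ ℚ)} (φ : BaseField V ≃+* BaseField V) (ρ : J ≃ J) :
    BigField J ≃+* BigField J :=
  IsFractionRing.ringEquivOfRingEquiv ((AddMonoidAlgebra.mapRingEquiv _ φ).trans
    (AddMonoidAlgebra.mapDomainRingEquiv _ (Finsupp.domCongr ρ : (J →₀ ℚ) ≃+ (J →₀ ℚ))))

lemma bigEquiv_term {J : Set (V →₀ ℚ)} (φ : BaseField V ≃+* BaseField V) (ρ : J ≃ J)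
    (u : BaseField V) (β : J →₀ ℚ) :
    bigEquiv φ ρ (term u β) = term (φ u) (Finsupp.domCongr ρ β) := by
  rw [bigEquiv, term, IsFractionRing.ringEquivOfRingEquiv_algebraMap, RingEquiv.trans_apply,
    AddMonoidAlgebra.mapRingEquiv_single, AddMonoidAlgebra.mapDomainRingEquiv_single, term]

variable {Γ : SimpleGraph V}

lemma domCongr_mem_graphMarks (π : Γ ≃g Γ) {m : V →₀ ℚ} (hm : m ∈ graphMarks Γ) :
    Finsupp.domCongr π.toEquiv m ∈ graphMarks Γ := by
  rcases hm with ⟨v, rfl⟩ | ⟨v, w, h, rfl⟩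
  · rw [Finsupp.domCongr_apply, Finsupp.equivMapDomain_single]
    exact single_mem_graphMarks _
  · rw [map_add, Finsupp.domCongr_apply, Finsupp.domCongr_apply, Finsupp.equivMapDomain_single,
      Finsupp.equivMapDomain_single]
    exact single_add_single_mem_graphMarks.2 (π.map_adj_iff.2 h)

/-- The permutation of the marks induced by a graph automorphism. -/
def marksEquiv (π : Γ ≃g Γ) : graphMarks Γ ≃ graphMarks Γ :=
  (Finsupp.domCongr π.toEquiv).toEquiv.subtypeEquiv fun m => by
    refine ⟨domCongr_mem_graphMarks π, fun h => ?_⟩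
    have := domCongr_mem_graphMarks π.symm h
    convert this
    exact ((Finsupp.domCongr π.toEquiv).symm_apply_apply m).symm

/-- The automorphism of `BigField (graphMarks Γ)` induced by a graph automorphism. -/
def bigAut (π : Γ ≃g Γ) : BigField (graphMarks Γ) ≃+* BigField (graphMarks Γ) :=
  bigEquiv (baseEquiv π.toEquiv) (marksEquiv π)

lemma bigAut_vertex (π : Γ ≃g Γ) (v : V) (q : ℚ) :
    bigAut π (term (eX (Finsupp.single v q)) 0) = term (eX (Finsupp.single (π v) q)) 0 := by
  rw [bigAut, bigEquiv_term, baseEquiv_eX, map_zero, Finsupp.domCongr_apply,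
    Finsupp.equivMapDomain_single]
  rfl

lemma bigAut_mark (π : Γ ≃g Γ) (j : graphMarks Γ) (q : ℚ) :
    bigAut π (term 1 (Finsupp.single j q)) = term 1 (Finsupp.single (marksEquiv π j) q) := by
  rw [bigAut, bigEquiv_term, map_one, Finsupp.domCongr_apply, Finsupp.equivMapDomain_single]

lemma bigAut_link (π : Γ ≃g Γ) (j : graphMarks Γ) (q r : ℚ) :
    bigAut π (term (1 + eX (r • j.1)) (Finsupp.single j q)) =
      term (1 + eX (r • (marksEquiv π j).1)) (Finsupp.single (marksEquiv π j) q) := by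
  rw [bigAut, bigEquiv_term, map_add, map_one, baseEquiv_eX,
    Finsupp.domCongr_apply _ (Finsupp.single _ _), Finsupp.equivMapDomain_single]
  congr 3
  ext v
  rfl

lemma map_bigAut (π : Γ ≃g Γ) :
    (markedField (graphMarks Γ)).map (bigAut π : BigField (graphMarks Γ) →+* _) =
      markedField (graphMarks Γ) := by
  rw [markedField, RingHom.map_field_closure]
  congr 1
  ext x
  constructor
  · rintro ⟨y, ⟨v, n⟩ | ⟨j, n⟩ | ⟨j, n⟩, rfl⟩
    · exact (bigAut_vertex π v _).symm ▸ IsGenerator.vertex (π v) n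
    · exact (bigAut_mark π j _).symm ▸ IsGenerator.mark (marksEquiv π j) n
    · exact (bigAut_link π j _ _).symm ▸ IsGenerator.link (marksEquiv π j) n
  · rintro (⟨v, n⟩ | ⟨j, n⟩ | ⟨j, n⟩)
    · obtain ⟨v, rfl⟩ := π.surjective v
      exact ⟨_, IsGenerator.vertex v n, bigAut_vertex π v _⟩
    · obtain ⟨j, rfl⟩ := (marksEquiv π).surjective j
      exact ⟨_, IsGenerator.mark j n, bigAut_mark π j _⟩
    · obtain ⟨j, rfl⟩ := (marksEquiv π).surjective j
      exact ⟨_, IsGenerator.link j n, bigAut_link π j _ _⟩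

/-- The field automorphism induced by a graph automorphism. -/
def graphFieldAut (π : Γ ≃g Γ) : GraphField Γ ≃+* GraphField Γ :=
  (bigAut π).restrict _ _ fun x => by
    nth_rewrite 2 [← map_bigAut π]
    rw [Subfield.mem_map]
    exact ⟨fun h => ⟨x, h, rfl⟩, fun ⟨y, hy, e⟩ => (bigAut π).injective e ▸ hy⟩

lemma vertexMap_graphFieldAut (π : Γ ≃g Γ) (v : V) : vertexMap (graphFieldAut π) v = π v := by
  apply vertexVar_injective
  rw [← apply_vertexVar]
  exact Subtype.ext (bigAut_vertex π v 1)

lemma toGraphAut_bijective (Γ : SimpleGraph V) : Function.Bijective (toGraphAut Γ) := by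
  refine ⟨(injective_iff_map_eq_one _).2 fun σ h => eq_one_of_vertexMap fun v => ?_,
    fun π => ⟨graphFieldAut π, RelIso.ext (vertexMap_graphFieldAut π)⟩⟩
  exact DFunLike.congr_fun h v

end Action

end FriedKollar

end

/-- Fried–Kollár theorem: every simple graph `Γ` can be realized as the automorphism
group of a field: there is a field `K` whose group of ring automorphisms is
isomorphic to the group of graph automorphisms of `Γ`. -/
theorem fried_kollar (V : Type) (Γ : SimpleGraph V) :
    ∃ (K : Type) (_ : Field K), Nonempty ((K ≃+* K) ≃* (Γ ≃g Γ)) :=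
  ⟨FriedKollar.GraphField Γ, inferInstance,
    ⟨MulEquiv.ofBijective _ (FriedKollar.toGraphAut_bijective Γ)⟩⟩
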